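/- First-level cancellation identities (Ω-terms): in the first-level interpolating setup, assume additionally p₀ > p₁ > 0, q₀ > q₁ > 0 and p₀q₀ > p₁q₁ > 0, and define Ω₁ = Σ_{i₁,i₂,j} β_{i₁} [ (√(1−t)/√p₁) T^p_{2,1,j}(i₁,i₂) − (√(1−t)/√(p₀−p₁)) T^p_{1,1,j}(i₁,i₂) ], Ω₂ = Σ_{i₁,i₂} β_{i₁} ‖y^{(i₂)}‖₂ [ (√(1−t)/√q₁) T^q_{2,2}(i₁,i₂) − (√(1−t)/√(q₀−q₁)) T^q_{1,2}(i₁,i₂) ], and Ω₃ = Σ_{i₁,i₂} β_{i₁} ‖y^{(i₂)}‖₂ [ (√t/√(p₁q₁)) T^{(p,q)}_{2,3}(i₁,i₂) − (√t/√(p₀q₀−p₁q₁)) T^{(p,q)}_{1,3}(i₁,i₂) ]. Then −Ω₁ = (1−t) s β² 𝔪₁ E_{G,𝒰₂}⟨‖x^{(i₁)}‖₂‖x^{(p₁)}‖₂ (y^{(p₂)})ᵀy^{(i₂)}⟩_{γ₂^{(1)}}, −Ω₂ = (1−t) s β² 𝔪₁ E_{G,𝒰₂}⟨‖y^{(i₂)}‖₂‖y^{(p₂)}‖₂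 (x^{(i₁)})ᵀx^{(p₁)}⟩_{γ₂^{(1)}}, and −Ω₃ = t s β² 𝔪₁ E_{G,𝒰₂}⟨‖x^{(i₁)}‖₂‖x^{(p₁)}‖₂‖y^{(i₂)}‖₂‖y^{(p₂)}‖₂⟩_{γ₂^{(1)}}. -/

import Mathlib

set_option linter.unusedVariables false

open MeasureTheory Real

namespace SFL

noncomputable section

/-- The sample space of one group `𝒰_k = (u^{(4,k)}, u^{(2,k)}, h^{(k)})`. -/
abbrev Us (m n : ℕ) : Type := ℝ × (Fin m → ℝ) × (Fin n → ℝ)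

/-- Standard Gaussian measure on `ℝ`. -/
def stdG : Measure ℝ := ProbabilityTheory.gaussianReal 0 1

/-- i.i.d. standard Gaussian vector measure. -/
def gVec (d : ℕ) : Measure (Fin d → ℝ) := Measure.pi fun _ => stdG

/-- i.i.d. standard Gaussian matrix measure. -/
def gMat (m n : ℕ) : Measure (Fin m → Fin n → ℝ) := Measure.pi fun _ => gVec n

/-- Law of one group `𝒰_k`. -/
def muU (m n : ℕ) : Measure (Us m n) := stdG.prod ((gVec m).prod (gVec n))

/-- Joint law of `(G, 𝒰₂)`. -/
def muGU (m n : ℕ) : Measure ((Fin m → Fin n → ℝ) × Us m n) := (gMat m n).prod (muU m n)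

/-- Euclidean norm. -/
def nrm2 {d : ℕ} (v : Fin d → ℝ) : ℝ := Real.sqrt (∑ i, v i ^ 2)

/-- Euclidean inner product. -/
def dotv {d : ℕ} (a b : Fin d → ℝ) : ℝ := ∑ i, a i * b i

variable {m n l : ℕ}

/-- The interpolating exponent `D₀^{(i₁,i₂)}`. -/
def D0 (β s t m1 p0 p1 q0 q1 : ℝ) (x : Fin l → Fin n → ℝ) (y : Fin l → Fin m → ℝ)
    (G : Fin m → Fin n → ℝ) (U1 U2 : Us m n) (i1 i2 : Fin l) : ℝ :=
  Real.sqrt t * (∑ j, ∑ k, y i2 j * (G j k * x i1 k))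
    + Real.sqrt (1 - t) * nrm2 (x i1) *
        (∑ j, y i2 j * (Real.sqrt (p0 - p1) * U1.2.1 j + Real.sqrt p1 * U2.2.1 j))
    + Real.sqrt t * nrm2 (x i1) * nrm2 (y i2) *
        (Real.sqrt (p0 * q0 - p1 * q1) * U1.1 + Real.sqrt (p1 * q1) * U2.1)
    + Real.sqrt (1 - t) * nrm2 (y i2) *
        (∑ k, (Real.sqrt (q0 - q1) * U1.2.2 k + Real.sqrt q1 * U2.2.2 k) * x i1 k)

/-- `A^{(i₁,i₂)} = exp (β D₀^{(i₁,i₂)})`. -/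
def Aq (β s t m1 p0 p1 q0 q1 : ℝ) (x : Fin l → Fin n → ℝ) (y : Fin l → Fin m → ℝ)
    (G : Fin m → Fin n → ℝ) (U1 U2 : Us m n) (i1 i2 : Fin l) : ℝ :=
  Real.exp (β * D0 β s t m1 p0 p1 q0 q1 x y G U1 U2 i1 i2)

/-- `C^{(i₁)}`. -/
def Cq (β s t m1 p0 p1 q0 q1 : ℝ) (x : Fin l → Fin n → ℝ) (y : Fin l → Fin m → ℝ)
    (G : Fin m → Fin n → ℝ) (U1 U2 : Us m n) (i1 : Fin l) : ℝ :=
  ∑ i2, Aq β s t m1 p0 p1 q0 q1 x y G U1 U2 i1 i2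

/-- `Z`. -/
def Zq (β s t m1 p0 p1 q0 q1 : ℝ) (x : Fin l → Fin n → ℝ) (y : Fin l → Fin m → ℝ)
    (G : Fin m → Fin n → ℝ) (U1 U2 : Us m n) : ℝ :=
  ∑ i1, Cq β s t m1 p0 p1 q0 q1 x y G U1 U2 i1 ^ s

/-- The first-level interpolating function `ψ`. -/
def psiq (β s t m1 p0 p1 q0 q1 : ℝ) (x : Fin l → Fin n → ℝ) (y : Fin l → Fin m → ℝ) : ℝ :=
  ∫ ω, (β * |s| * Real.sqrt (n : ℝ) * m1)⁻¹ *
      Real.log (∫ U1, Zq β s t m1 p0 p1 q0 q1 x y ω.1 U1 ω.2 ^ m1 ∂ muU m n) ∂ muGU m n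

/-- The operator `Φ_{𝒰₁}`. -/
def Phiq (β s t m1 p0 p1 q0 q1 : ℝ) (x : Fin l → Fin n → ℝ) (y : Fin l → Fin m → ℝ)
    (G : Fin m → Fin n → ℝ) (U2 : Us m n) (f : Us m n → ℝ) : ℝ :=
  (∫ U1, Zq β s t m1 p0 p1 q0 q1 x y G U1 U2 ^ m1 * f U1 ∂ muU m n) /
    (∫ U1, Zq β s t m1 p0 p1 q0 q1 x y G U1 U2 ^ m1 ∂ muU m n)

/-- `γ₀(i₁,i₂)` as a function of `𝒰₁`. -/
def gam0 (β s t m1 p0 p1 q0 q1 : ℝ) (x : Fin l → Fin n → ℝ) (y : Fin l → Fin m → ℝ)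
    (G : Fin m → Fin n → ℝ) (U2 : Us m n) (i1 i2 : Fin l) (U1 : Us m n) : ℝ :=
  Cq β s t m1 p0 p1 q0 q1 x y G U1 U2 i1 ^ s / Zq β s t m1 p0 p1 q0 q1 x y G U1 U2 *
    (Aq β s t m1 p0 p1 q0 q1 x y G U1 U2 i1 i2 / Cq β s t m1 p0 p1 q0 q1 x y G U1 U2 i1)

/-- `γ₀₁^{(1)}`. -/
def gam01 (β s t m1 p0 p1 q0 q1 : ℝ) (x : Fin l → Fin n → ℝ) (y : Fin l → Fin m → ℝ)
    (G : Fin m → Fin n → ℝ) (U2 : Us m n) (i1 i2 : Fin l) : ℝ :=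
  Phiq β s t m1 p0 p1 q0 q1 x y G U2 (gam0 β s t m1 p0 p1 q0 q1 x y G U2 i1 i2)

/-- `γ₀₂^{(1)}`. -/
def gam02 (β s t m1 p0 p1 q0 q1 : ℝ) (x : Fin l → Fin n → ℝ) (y : Fin l → Fin m → ℝ)
    (G : Fin m → Fin n → ℝ) (U2 : Us m n) (i1 i2 p2 : Fin l) : ℝ :=
  Phiq β s t m1 p0 p1 q0 q1 x y G U2
    (fun U1 => gam0 β s t m1 p0 p1 q0 q1 x y G U2 i1 i2 U1 *
      gam0 β s t m1 p0 p1 q0 q1 x y G U2 i1 p2 U1)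

/-- `γ₁^{(1)}`. -/
def gam1 (β s t m1 p0 p1 q0 q1 : ℝ) (x : Fin l → Fin n → ℝ) (y : Fin l → Fin m → ℝ)
    (G : Fin m → Fin n → ℝ) (U2 : Us m n) (i1 i2 pp1 pp2 : Fin l) : ℝ :=
  Phiq β s t m1 p0 p1 q0 q1 x y G U2
    (fun U1 => gam0 β s t m1 p0 p1 q0 q1 x y G U2 i1 i2 U1 *
      gam0 β s t m1 p0 p1 q0 q1 x y G U2 pp1 pp2 U1)

/-- `γ₂^{(1)}`. -/
def gam2 (β s t m1 p0 p1 q0 q1 : ℝ) (x : Fin l → Fin n → ℝ) (y : Fin l → Fin m → ℝ)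
    (G : Fin m → Fin n → ℝ) (U2 : Us m n) (i1 i2 pp1 pp2 : Fin l) : ℝ :=
  Phiq β s t m1 p0 p1 q0 q1 x y G U2 (gam0 β s t m1 p0 p1 q0 q1 x y G U2 i1 i2) *
    Phiq β s t m1 p0 p1 q0 q1 x y G U2 (gam0 β s t m1 p0 p1 q0 q1 x y G U2 pp1 pp2)

/-- `E_{G,𝒰₂} ⟨f⟩_{γ₀₁^{(1)}}`. -/
def EB01 (β s t m1 p0 p1 q0 q1 : ℝ) (x : Fin l → Fin n → ℝ) (y : Fin l → Fin m → ℝ)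
    (f : Fin l → Fin l → ℝ) : ℝ :=
  ∫ ω, (∑ i1, ∑ i2, f i1 i2 * gam01 β s t m1 p0 p1 q0 q1 x y ω.1 ω.2 i1 i2) ∂ muGU m n

/-- `E_{G,𝒰₂} ⟨f⟩_{γ₀₂^{(1)}}`. -/
def EB02 (β s t m1 p0 p1 q0 q1 : ℝ) (x : Fin l → Fin n → ℝ) (y : Fin l → Fin m → ℝ)
    (f : Fin l → Fin l → Fin l → ℝ) : ℝ :=
  ∫ ω, (∑ i1, ∑ i2, ∑ p2, f i1 i2 p2 * gam02 β s t m1 p0 p1 q0 q1 x y ω.1 ω.2 i1 i2 p2) ∂ muGU m n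

/-- `E_{G,𝒰₂} ⟨f⟩_{γ₁^{(1)}}`. -/
def EB1 (β s t m1 p0 p1 q0 q1 : ℝ) (x : Fin l → Fin n → ℝ) (y : Fin l → Fin m → ℝ)
    (f : Fin l → Fin l → Fin l → Fin l → ℝ) : ℝ :=
  ∫ ω, (∑ i1, ∑ i2, ∑ pp1, ∑ pp2,
      f i1 i2 pp1 pp2 * gam1 β s t m1 p0 p1 q0 q1 x y ω.1 ω.2 i1 i2 pp1 pp2) ∂ muGU m n

/-- `E_{G,𝒰₂} ⟨f⟩_{γ₂^{(1)}}`. -/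
def EB2 (β s t m1 p0 p1 q0 q1 : ℝ) (x : Fin l → Fin n → ℝ) (y : Fin l → Fin m → ℝ)
    (f : Fin l → Fin l → Fin l → Fin l → ℝ) : ℝ :=
  ∫ ω, (∑ i1, ∑ i2, ∑ pp1, ∑ pp2,
      f i1 i2 pp1 pp2 * gam2 β s t m1 p0 p1 q0 q1 x y ω.1 ω.2 i1 i2 pp1 pp2) ∂ muGU m n

/-- `T^p_{1,1,j}(i₁,i₂)`. -/
def Tp11 (β s t m1 p0 p1 q0 q1 : ℝ) (x : Fin l → Fin n → ℝ) (y : Fin l → Fin m → ℝ)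
    (j : Fin m) (i1 i2 : Fin l) : ℝ :=
  ∫ ω, (∫ U1, Zq β s t m1 p0 p1 q0 q1 x y ω.1 U1 ω.2 ^ m1 ∂ muU m n)⁻¹ *
      (∫ U1, Zq β s t m1 p0 p1 q0 q1 x y ω.1 U1 ω.2 ^ (m1 - 1) *
          Cq β s t m1 p0 p1 q0 q1 x y ω.1 U1 ω.2 i1 ^ (s - 1) *
          Aq β s t m1 p0 p1 q0 q1 x y ω.1 U1 ω.2 i1 i2 * y i2 j * U1.2.1 j ∂ muU m n) ∂ muGU m n

/-- `T^p_{2,1,j}(i₁,i₂)`. -/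
def Tp21 (β s t m1 p0 p1 q0 q1 : ℝ) (x : Fin l → Fin n → ℝ) (y : Fin l → Fin m → ℝ)
    (j : Fin m) (i1 i2 : Fin l) : ℝ :=
  ∫ ω, (∫ U1, Zq β s t m1 p0 p1 q0 q1 x y ω.1 U1 ω.2 ^ m1 ∂ muU m n)⁻¹ *
      (∫ U1, Zq β s t m1 p0 p1 q0 q1 x y ω.1 U1 ω.2 ^ (m1 - 1) *
          Cq β s t m1 p0 p1 q0 q1 x y ω.1 U1 ω.2 i1 ^ (s - 1) *
          Aq β s t m1 p0 p1 q0 q1 x y ω.1 U1 ω.2 i1 i2 * y i2 j * ω.2.2.1 j ∂ muU m n) ∂ muGU m n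

/-- `T^q_{1,2}(i₁,i₂)`. -/
def Tq12 (β s t m1 p0 p1 q0 q1 : ℝ) (x : Fin l → Fin n → ℝ) (y : Fin l → Fin m → ℝ)
    (i1 i2 : Fin l) : ℝ :=
  ∫ ω, (∫ U1, Zq β s t m1 p0 p1 q0 q1 x y ω.1 U1 ω.2 ^ m1 ∂ muU m n)⁻¹ *
      (∫ U1, Zq β s t m1 p0 p1 q0 q1 x y ω.1 U1 ω.2 ^ (m1 - 1) *
          Cq β s t m1 p0 p1 q0 q1 x y ω.1 U1 ω.2 i1 ^ (s - 1) *
          Aq β s t m1 p0 p1 q0 q1 x y ω.1 U1 ω.2 i1 i2 *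
          (dotv U1.2.2 (x i1) / nrm2 (x i1)) ∂ muU m n) ∂ muGU m n

/-- `T^q_{2,2}(i₁,i₂)`. -/
def Tq22 (β s t m1 p0 p1 q0 q1 : ℝ) (x : Fin l → Fin n → ℝ) (y : Fin l → Fin m → ℝ)
    (i1 i2 : Fin l) : ℝ :=
  ∫ ω, (∫ U1, Zq β s t m1 p0 p1 q0 q1 x y ω.1 U1 ω.2 ^ m1 ∂ muU m n)⁻¹ *
      (∫ U1, Zq β s t m1 p0 p1 q0 q1 x y ω.1 U1 ω.2 ^ (m1 - 1) *
          Cq β s t m1 p0 p1 q0 q1 x y ω.1 U1 ω.2 i1 ^ (s - 1) *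
          Aq β s t m1 p0 p1 q0 q1 x y ω.1 U1 ω.2 i1 i2 *
          (dotv ω.2.2.2 (x i1) / nrm2 (x i1)) ∂ muU m n) ∂ muGU m n

/-- `T^{(p,q)}_{1,3}(i₁,i₂)`. -/
def Tpq13 (β s t m1 p0 p1 q0 q1 : ℝ) (x : Fin l → Fin n → ℝ) (y : Fin l → Fin m → ℝ)
    (i1 i2 : Fin l) : ℝ :=
  ∫ ω, (∫ U1, Zq β s t m1 p0 p1 q0 q1 x y ω.1 U1 ω.2 ^ m1 ∂ muU m n)⁻¹ *
      (∫ U1, Zq β s t m1 p0 p1 q0 q1 x y ω.1 U1 ω.2 ^ (m1 - 1) *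
          Cq β s t m1 p0 p1 q0 q1 x y ω.1 U1 ω.2 i1 ^ (s - 1) *
          Aq β s t m1 p0 p1 q0 q1 x y ω.1 U1 ω.2 i1 i2 * U1.1 ∂ muU m n) ∂ muGU m n

/-- `T^{(p,q)}_{2,3}(i₁,i₂)`. -/
def Tpq23 (β s t m1 p0 p1 q0 q1 : ℝ) (x : Fin l → Fin n → ℝ) (y : Fin l → Fin m → ℝ)
    (i1 i2 : Fin l) : ℝ :=
  ∫ ω, (∫ U1, Zq β s t m1 p0 p1 q0 q1 x y ω.1 U1 ω.2 ^ m1 ∂ muU m n)⁻¹ *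
      (∫ U1, Zq β s t m1 p0 p1 q0 q1 x y ω.1 U1 ω.2 ^ (m1 - 1) *
          Cq β s t m1 p0 p1 q0 q1 x y ω.1 U1 ω.2 i1 ^ (s - 1) *
          Aq β s t m1 p0 p1 q0 q1 x y ω.1 U1 ω.2 i1 i2 * ω.2.1 ∂ muU m n) ∂ muGU m n


/-! ### Gaussian integration by parts along a direction -/

/-- `μ` satisfies the Gaussian integration by parts formula for the coordinate `X` along `v`. -/
def HasIBP {Ω : Type*} [AddCommGroup Ω] [Module ℝ Ω] [MeasurableSpace Ω] (μ : Measure Ω)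
    (X : Ω → ℝ) (v : Ω) : Prop :=
  ∀ F F' : Ω → ℝ, (∀ ω, HasDerivAt (fun r : ℝ => F (ω + r • v)) (F' ω) 0) →
    Integrable F μ → Integrable (fun ω => X ω * F ω) μ → Integrable F' μ →
    ∫ ω, X ω * F ω ∂μ = ∫ ω, F' ω ∂μ

/-- Exponential moments of the norm. -/
def ExpM {Ω : Type*} [NormedAddCommGroup Ω] [MeasurableSpace Ω] (μ : Measure Ω) : Prop :=
  ∀ K : ℝ, Integrable (fun ω => Real.exp (K * ‖ω‖)) μ

instance : IsProbabilityMeasure stdG := by unfold stdG; infer_instance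
instance (d : ℕ) : IsProbabilityMeasure (gVec d) := by unfold gVec; infer_instance
instance (m n : ℕ) : IsProbabilityMeasure (gMat m n) := by unfold gMat; infer_instance
instance (m n : ℕ) : IsProbabilityMeasure (muU m n) := by unfold muU; infer_instance
instance (m n : ℕ) : IsProbabilityMeasure (muGU m n) := by unfold muGU; infer_instance

lemma integrable_stdG_iff (f : ℝ → ℝ) :
    Integrable f stdG ↔ Integrable (fun x => ProbabilityTheory.gaussianPDFReal 0 1 x * f x) := by
  unfold stdG
  rw [ProbabilityTheory.gaussianReal_of_var_ne_zero _ one_ne_zero]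
  rw [integrable_withDensity_iff_integrable_smul₀'
    (ProbabilityTheory.measurable_gaussianPDF _ _).aemeasurable
    (Filter.Eventually.of_forall fun x => ProbabilityTheory.gaussianPDF_lt_top)]
  simp [ProbabilityTheory.toReal_gaussianPDF]

lemma hasDerivAt_gpdf (x : ℝ) : HasDerivAt (ProbabilityTheory.gaussianPDFReal 0 1)
    (-(x * ProbabilityTheory.gaussianPDFReal 0 1 x)) x := by
  unfold ProbabilityTheory.gaussianPDFReal
  have h1 : HasDerivAt (fun x : ℝ => -(x - 0) ^ 2 / (2 * ((1 : NNReal) : ℝ))) (-x) x := by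
    have := (((hasDerivAt_id x).sub_const 0).pow 2).neg.div_const (2 * ((1 : NNReal) : ℝ))
    refine HasDerivAt.congr_deriv this ?_
    simp; ring
  have := (h1.exp).const_mul ((√(2 * π * ((1 : NNReal) : ℝ)))⁻¹)
  refine HasDerivAt.congr_deriv this ?_
  ring

lemma hasIBP_stdG : HasIBP stdG (fun x => x) 1 := by
  intro F F' hF hi hXi hi'
  have hd : ∀ x, HasDerivAt F (F' x) x := by
    intro x
    have h := hF x
    have h2 : HasDerivAt (fun y : ℝ => y - x) 1 x := (hasDerivAt_id x).sub_const x
    have h3 := HasDerivAt.comp x (h₂ := fun r : ℝ => F (x + r • 1)) (h := fun y => y - x)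
      (by simpa using h) h2
    have h4 : ((fun r : ℝ => F (x + r • 1)) ∘ fun y => y - x) = F := by funext y; simp
    rw [h4, mul_one] at h3
    exact h3
  rw [integrable_stdG_iff] at hi hXi hi'
  have key := integral_mul_deriv_eq_deriv_mul_of_integrable
    (u := ProbabilityTheory.gaussianPDFReal 0 1) (v := F) (fun x _ => hasDerivAt_gpdf x)
    (fun x _ => hd x) hi' (by
      refine (hXi.neg).congr (Filter.Eventually.of_forall fun x => ?_)
      simp only [Pi.neg_apply, Pi.mul_apply]; ring) hi
  unfold stdG
  rw [ProbabilityTheory.integral_gaussianReal_eq_integral_smul one_ne_zero,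
    ProbabilityTheory.integral_gaussianReal_eq_integral_smul one_ne_zero]
  simp only [smul_eq_mul]
  rw [key, ← integral_neg]
  congr 1; funext x; ring

section
variable {Ω Ω' : Type*} [AddCommGroup Ω] [Module ℝ Ω] [MeasurableSpace Ω]
  [AddCommGroup Ω'] [Module ℝ Ω'] [MeasurableSpace Ω']

lemma HasIBP.prod_right {μ : Measure Ω} {ν : Measure Ω'} [SFinite μ] [SFinite ν]
    {X : Ω' → ℝ} {v : Ω'} (h : HasIBP ν X v) : HasIBP (μ.prod ν) (fun p => X p.2) (0, v) := by
  intro F F' hF hi hXi hi'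
  rw [integral_prod _ hXi, integral_prod _ hi']
  refine integral_congr_ae ?_
  filter_upwards [hi.prod_right_ae, hXi.prod_right_ae, hi'.prod_right_ae] with a h1 h2 h3
  refine h (fun b => F (a, b)) (fun b => F' (a, b)) (fun b => ?_) h1 h2 h3
  simpa using hF (a, b)

lemma HasIBP.prod_left {μ : Measure Ω} {ν : Measure Ω'} [SFinite μ] [SFinite ν]
    {X : Ω → ℝ} {v : Ω} (h : HasIBP μ X v) : HasIBP (μ.prod ν) (fun p => X p.1) (v, 0) := by
  intro F F' hF hi hXi hi'
  rw [integral_prod_symm _ hXi, integral_prod_symm _ hi']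
  refine integral_congr_ae ?_
  filter_upwards [hi.prod_left_ae, hXi.prod_left_ae, hi'.prod_left_ae] with a h1 h2 h3
  refine h (fun b => F (b, a)) (fun b => F' (b, a)) (fun b => ?_) h1 h2 h3
  simpa using hF (b, a)

lemma HasIBP.equiv {μ : Measure Ω} {ν : Measure Ω'} (e : Ω' ≃ᵐ Ω) (he : MeasurePreserving e ν μ)
    {X : Ω → ℝ} {v : Ω} {w : Ω'} (h : HasIBP ν (fun a => X (e a)) w)
    (hvw : ∀ a (r : ℝ), e (a + r • w) = e a + r • v) : HasIBP μ X v := by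
  intro F F' hF hi hXi hi'
  rw [← he.integral_comp', ← he.integral_comp']
  refine h (fun a => F (e a)) (fun a => F' (e a)) (fun a => ?_) ?_ ?_ ?_
  · simpa [hvw] using hF (e a)
  · exact (he.integrable_comp_emb e.measurableEmbedding).2 hi
  · exact (he.integrable_comp_emb e.measurableEmbedding).2 hXi
  · exact (he.integrable_comp_emb e.measurableEmbedding).2 hi'
end

lemma hasIBP_gVec {d : ℕ} (j : Fin d) : HasIBP (gVec d) (fun u => u j) (Pi.single j 1) := by
  cases d with
  | zero => exact j.elim0
  | succ d =>
    have mp := (measurePreserving_piFinSuccAbove (fun _ : Fin (d+1) => stdG) j).symm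
    refine HasIBP.equiv (w := ((1 : ℝ), (0 : Fin d → ℝ))) _ mp ?_ ?_
    · have := hasIBP_stdG.prod_left (ν := Measure.pi (fun _ : Fin d => stdG))
      simpa using this
    · rintro ⟨a, b⟩ r
      funext k
      change Fin.insertNth (α := fun _ => ℝ) j (a + r • 1) (b + r • 0) k
        = Fin.insertNth (α := fun _ => ℝ) j a b k + r • (Pi.single j 1 : Fin (d+1) → ℝ) k
      refine Fin.succAboveCases j ?_ (fun k => ?_) k <;> simp

lemma expM_stdG : ExpM stdG := by
  intro K
  unfold stdG
  simp only [Real.norm_eq_abs]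
  refine ((ProbabilityTheory.integrable_exp_mul_gaussianReal (μ := 0) (v := 1) K).add
    (ProbabilityTheory.integrable_exp_mul_gaussianReal (μ := 0) (v := 1) (-K))).mono'
    (by fun_prop) (Filter.Eventually.of_forall fun x => ?_)
  simp only [Real.norm_eq_abs, Real.abs_exp, Pi.add_apply]
  rcases abs_cases x with ⟨h, _⟩ | ⟨h, _⟩ <;> rw [h]
  · linarith [Real.exp_pos (-K * x)]
  · rw [mul_neg, ← neg_mul]; linarith [Real.exp_pos (K * x)]

lemma ExpM.prod {Ω Ω' : Type*} [NormedAddCommGroup Ω] [MeasurableSpace Ω] [BorelSpace Ω]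
    [NormedAddCommGroup Ω'] [MeasurableSpace Ω'] [BorelSpace Ω']
    {μ : Measure Ω} {ν : Measure Ω'} [SFinite μ] [SFinite ν]
    (h : ExpM μ) (h' : ExpM ν) : ExpM (μ.prod ν) := by
  intro K
  refine ((h |K|).mul_prod (h' |K|)).mono' ?_ (Filter.Eventually.of_forall fun p => ?_)
  · refine Measurable.aestronglyMeasurable ?_
    simp only [Prod.norm_def]
    have h1 : Measurable fun p : Ω × Ω' => ‖p.1‖ := measurable_norm.comp measurable_fst
    have h2 : Measurable fun p : Ω × Ω' => ‖p.2‖ := measurable_norm.comp measurable_snd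
    exact Real.measurable_exp.comp ((h1.max h2).const_mul K)
  · simp only [Real.norm_eq_abs, Real.abs_exp, ← Real.exp_add]
    apply Real.exp_le_exp.2
    have h1 : ‖p‖ ≤ ‖p.1‖ + ‖p.2‖ := by
      rw [Prod.norm_def]
      exact max_le (by linarith [norm_nonneg p.2]) (by linarith [norm_nonneg p.1])
    calc K * ‖p‖ ≤ |K| * ‖p‖ := by gcongr; exact le_abs_self K
      _ ≤ |K| * (‖p.1‖ + ‖p.2‖) := by gcongr
      _ = _ := by ring

lemma expM_gVec (d : ℕ) : ExpM (gVec d) := by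
  intro K
  unfold gVec
  have := Integrable.fintype_prod (μ := fun _ : Fin d => stdG)
    (f := fun (_ : Fin d) (x : ℝ) => Real.exp (|K| * ‖x‖)) (fun _ => expM_stdG |K|)
  refine this.mono' (by fun_prop) (Filter.Eventually.of_forall fun p => ?_)
  simp only [Real.norm_eq_abs, Real.abs_exp, ← Real.exp_sum, ← Finset.mul_sum]
  apply Real.exp_le_exp.2
  have h1 : ‖p‖ ≤ ∑ i, |p i| := by
    refine (pi_norm_le_iff_of_nonneg (by positivity)).2 fun i => ?_
    rw [Real.norm_eq_abs]
    exact Finset.single_le_sum (f := fun i => |p i|) (fun i _ => abs_nonneg _) (Finset.mem_univ i)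
  calc K * ‖p‖ ≤ |K| * ‖p‖ := by gcongr; exact le_abs_self K
      _ ≤ _ := by gcongr

lemma expM_muU (m n : ℕ) : ExpM (muU m n) := expM_stdG.prod ((expM_gVec m).prod (expM_gVec n))

/-! ### The abstract cancellation lemma -/

/-- Continuous functions of at most exponential growth. -/
def Gd {J : Type*} [NormedAddCommGroup J] (f : J → ℝ) : Prop :=
  Continuous f ∧ ∃ c k : ℝ, 0 ≤ c ∧ 0 ≤ k ∧ ∀ D, |f D| ≤ c * Real.exp (k * ‖D‖)

section abs
set_option linter.unusedSectionVars false
variable {E F J : Type*} [NormedAddCommGroup E] [NormedSpace ℝ E] [MeasurableSpace E]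
  [BorelSpace E] [SecondCountableTopology E]
  [NormedAddCommGroup F] [NormedSpace ℝ F] [MeasurableSpace F]
  [BorelSpace F] [SecondCountableTopology F]
  [NormedAddCommGroup J] [NormedSpace ℝ J]

lemma norm_L_le (L : E × F →L[ℝ] J) (ω : E) (u : F) : ‖L (ω, u)‖ ≤ ‖L‖ * ‖ω‖ + ‖L‖ * ‖u‖ := by
  refine (L.le_opNorm _).trans ?_
  rw [← mul_add]
  gcongr
  rw [Prod.norm_def]
  exact max_le (by simp) (by simp)

lemma Gd.integrable {μ : Measure F} (hμ : ExpM μ) (L : E × F →L[ℝ] J) {f : J → ℝ} (hf : Gd f)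
    (ω : E) : Integrable (fun u => f (L (ω, u))) μ := by
  obtain ⟨hc, c, k, hc0, hk0, hb⟩ := hf
  refine ((hμ (k * ‖L‖)).const_mul (c * Real.exp (k * (‖L‖ * ‖ω‖)))).mono'
    (Continuous.aestronglyMeasurable (by fun_prop)) (Filter.Eventually.of_forall fun u => ?_)
  rw [Real.norm_eq_abs]
  refine (hb _).trans ?_
  rw [mul_assoc, ← Real.exp_add]
  gcongr
  have := mul_le_mul_of_nonneg_left (norm_L_le L ω u) hk0
  linarith

lemma Gd.integrable_mul {μ : Measure F} (hμ : ExpM μ) (L : E × F →L[ℝ] J) {f : J → ℝ} (hf : Gd f)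
    (ω : E) {X : F → ℝ} (hX : Continuous X) (hXb : ∀ u, |X u| ≤ ‖u‖) :
    Integrable (fun u => f (L (ω, u)) * X u) μ := by
  obtain ⟨hc, c, k, hc0, hk0, hb⟩ := hf
  refine ((hμ (k * ‖L‖ + 1)).const_mul (c * Real.exp (k * (‖L‖ * ‖ω‖)))).mono'
    (Continuous.aestronglyMeasurable (by fun_prop)) (Filter.Eventually.of_forall fun u => ?_)
  rw [Real.norm_eq_abs, abs_mul]
  have h1 : |X u| ≤ Real.exp ‖u‖ := (hXb u).trans (by linarith [Real.add_one_le_exp ‖u‖])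
  refine (mul_le_mul (hb _) h1 (abs_nonneg _) (by positivity)).trans ?_
  rw [mul_assoc, mul_assoc, ← Real.exp_add, ← Real.exp_add]
  refine mul_le_mul_of_nonneg_left (Real.exp_le_exp.2 ?_) hc0
  have := mul_le_mul_of_nonneg_left (norm_L_le L ω u) hk0
  linarith

lemma meas_int {μ : Measure F} [SFinite μ] (L : E × F →L[ℝ] J) {f : J → ℝ} (hf : Gd f) :
    Measurable (fun ω => ∫ u, f (L (ω, u)) ∂μ) := by
  have h : StronglyMeasurable (fun p : E × F => f (L p)) :=
    (hf.1.comp L.continuous).stronglyMeasurable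
  exact (h.integral_prod_right' (ν := μ)).measurable

lemma deriv_shift {f f' : J → ℝ} {d : J} (df : ∀ D, HasDerivAt (fun r : ℝ => f (D + r • d)) (f' D) 0)
    (a : ℝ) (D : J) (r : ℝ) :
    HasDerivAt (fun r : ℝ => f (D + (r * a) • d)) (a * f' (D + (r * a) • d)) r := by
  have h1 := df (D + (r * a) • d)
  have h2 : HasDerivAt (fun y : ℝ => y * a - r * a) a r := by
    simpa using ((hasDerivAt_id r).mul_const a).sub_const (r * a)
  have h3 := HasDerivAt.comp r (h₂ := fun q : ℝ => f (D + (r * a) • d + q • d))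
      (h := fun y => y * a - r * a) (by simpa using h1) h2
  have h4 : ((fun q : ℝ => f (D + (r * a) • d + q • d)) ∘ fun y => y * a - r * a)
      = (fun r : ℝ => f (D + (r * a) • d)) := by
    funext y
    simp only [Function.comp_apply]
    rw [add_assoc, ← add_smul]
    congr 3; ring
  rw [h4, mul_comm] at h3
  exact h3

lemma deriv_int {μ : Measure F} (hμ : ExpM μ) (L : E × F →L[ℝ] J) {f f' : J → ℝ}
    (hf : Gd f) (hf' : Gd f') {d : J}
    (df : ∀ D, HasDerivAt (fun r : ℝ => f (D + r • d)) (f' D) 0)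
    {v : E} {a : ℝ} (hL : L (v, 0) = a • d) (ω : E) :
    HasDerivAt (fun r : ℝ => ∫ u, f (L (ω + r • v, u)) ∂μ) (a * ∫ u, f' (L (ω, u)) ∂μ) 0 := by
  have hLr : ∀ (r : ℝ) u, L (ω + r • v, u) = L (ω, u) + (r * a) • d := by
    intro r u
    have : ((ω + r • v, u) : E × F) = (ω, u) + r • (v, 0) := by ext <;> simp
    rw [this, map_add, map_smul, hL, smul_smul]
  simp only [hLr]
  have hfc := hf.1
  have hfc' := hf'.1
  have hfi := hf.integrable hμ L ω
  obtain ⟨hc, c, k, hc0, hk0, hb⟩ := hf'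
  have key := hasDerivAt_integral_of_dominated_loc_of_deriv_le (μ := μ)
    (F := fun (r : ℝ) u => f (L (ω, u) + (r * a) • d))
    (F' := fun (r : ℝ) u => a * f' (L (ω, u) + (r * a) • d)) (x₀ := 0)
    (bound := fun u => |a| * (c * Real.exp (k * (‖L‖ * ‖ω‖ + |a| * ‖d‖))) *
      Real.exp ((k * ‖L‖) * ‖u‖))
    (Metric.ball_mem_nhds (0 : ℝ) one_pos)
    (Filter.Eventually.of_forall fun r => Continuous.aestronglyMeasurable (by fun_prop))
    (by simpa using hfi)
    (Continuous.aestronglyMeasurable (by fun_prop))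
    (Filter.Eventually.of_forall fun u r hr => ?_)
    ((hμ (k * ‖L‖)).const_mul _)
    (Filter.Eventually.of_forall fun u r hr => deriv_shift df a _ r)
  · have := key.2
    simp only [zero_mul, zero_smul, add_zero, integral_const_mul] at this
    exact this
  · rw [Real.norm_eq_abs, abs_mul, mul_assoc, mul_assoc, ← Real.exp_add]
    gcongr
    refine (hb _).trans ?_
    gcongr
    have hr' : |r| ≤ 1 := by
      rw [mem_ball_zero_iff, Real.norm_eq_abs] at hr; exact hr.le
    have h1 : ‖L (ω, u) + (r * a) • d‖ ≤ ‖L‖ * ‖ω‖ + ‖L‖ * ‖u‖ + |a| * ‖d‖ := by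
      refine (norm_add_le _ _).trans (add_le_add (norm_L_le L ω u) ?_)
      rw [norm_smul, Real.norm_eq_abs, abs_mul]
      gcongr
      calc |r| * |a| ≤ 1 * |a| := by gcongr
        _ = |a| := one_mul _
    have := mul_le_mul_of_nonneg_left h1 hk0
    linarith

lemma main_abs (P : Measure E) [IsProbabilityMeasure P] (μ : Measure F) [IsProbabilityMeasure μ]
    (L : E × F →L[ℝ] J) (d : J) (v2 : E) (v1 : F) (a1 a2 : ℝ) (ha1 : a1 ≠ 0) (ha2 : a2 ≠ 0)
    (hL2 : L (v2, 0) = a2 • d) (hL1 : L (0, v1) = a1 • d)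
    (X2 : E → ℝ) (X1 : F → ℝ) (hX2 : Integrable X2 P) (hX1 : Continuous X1)
    (hX1b : ∀ u, |X1 u| ≤ ‖u‖) (ibp2 : HasIBP P X2 v2) (ibp1 : HasIBP μ X1 v1) (hμ : ExpM μ)
    (z h z' h' : J → ℝ) (gz : Gd z) (gh : Gd h) (gz' : Gd z') (gh' : Gd h')
    (zpos : ∀ D, 0 < z D) (K K' : ℝ) (hb : ∀ D, |h D| ≤ z D) (hb' : ∀ D, |h' D| ≤ K * z D)
    (hz' : ∀ D, |z' D| ≤ K' * z D)
    (dh : ∀ D, HasDerivAt (fun r : ℝ => h (D + r • d)) (h' D) 0)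
    (dz : ∀ D, HasDerivAt (fun r : ℝ => z (D + r • d)) (z' D) 0) :
    Integrable (fun ω => (∫ u, z (L (ω, u)) ∂μ)⁻¹ * ∫ u, h (L (ω, u)) * X1 u ∂μ) P ∧
    Integrable (fun ω => (∫ u, z (L (ω, u)) ∂μ)⁻¹ * ∫ u, h (L (ω, u)) * X2 ω ∂μ) P ∧
    a2⁻¹ * (∫ ω, (∫ u, z (L (ω, u)) ∂μ)⁻¹ * (∫ u, h (L (ω, u)) * X2 ω ∂μ) ∂P)
      - a1⁻¹ * (∫ ω, (∫ u, z (L (ω, u)) ∂μ)⁻¹ * (∫ u, h (L (ω, u)) * X1 u ∂μ) ∂P)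
      = - ∫ ω, ((∫ u, z (L (ω, u)) ∂μ)⁻¹ * (∫ u, h (L (ω, u)) ∂μ)) *
          ((∫ u, z (L (ω, u)) ∂μ)⁻¹ * (∫ u, z' (L (ω, u)) ∂μ)) ∂P := by
  set M : E → ℝ := fun ω => ∫ u, z (L (ω, u)) ∂μ with hM
  set N : E → ℝ := fun ω => ∫ u, h (L (ω, u)) ∂μ with hN
  set M' : E → ℝ := fun ω => ∫ u, z' (L (ω, u)) ∂μ with hM'
  set N' : E → ℝ := fun ω => ∫ u, h' (L (ω, u)) ∂μ with hN'
  have Mpos : ∀ ω, 0 < M ω := fun ω => by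
    refine (integral_pos_iff_support_of_nonneg (fun u => (zpos _).le) (gz.integrable hμ L ω)).2 ?_
    have : Function.support (fun u => z (L (ω, u))) = Set.univ := by
      ext u; simp [(zpos _).ne']
    rw [this]; simp
  have bd : ∀ (f : J → ℝ) (C : ℝ), Gd f → (∀ D, |f D| ≤ C * z D) →
      ∀ ω, |(M ω)⁻¹ * ∫ u, f (L (ω, u)) ∂μ| ≤ C := by
    intro f C gf hf ω
    rw [abs_mul, abs_inv, abs_of_pos (Mpos ω), inv_mul_le_iff₀ (Mpos ω)]
    calc |∫ u, f (L (ω, u)) ∂μ| ≤ ∫ u, |f (L (ω, u))| ∂μ := abs_integral_le_integral_abs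
      _ ≤ ∫ u, C * z (L (ω, u)) ∂μ :=
        integral_mono (gf.integrable hμ L ω).abs ((gz.integrable hμ L ω).const_mul C)
          (fun u => hf _)
      _ = M ω * C := by rw [integral_const_mul, mul_comm]
  have mM : Measurable M := meas_int L gz
  have mN : Measurable N := meas_int L gh
  have mM' : Measurable M' := meas_int L gz'
  have mN' : Measurable N' := meas_int L gh'
  have bN : ∀ ω, |(M ω)⁻¹ * N ω| ≤ 1 := bd h 1 gh (by simpa using hb)
  have bN' : ∀ ω, |(M ω)⁻¹ * N' ω| ≤ K := bd h' K gh' hb'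
  have bM' : ∀ ω, |(M ω)⁻¹ * M' ω| ≤ K' := bd z' K' gz' hz'
  have iN : Integrable (fun ω => (M ω)⁻¹ * N ω) P :=
    Integrable.of_bound (by fun_prop) 1 (Filter.Eventually.of_forall bN)
  have iN' : Integrable (fun ω => (M ω)⁻¹ * N' ω) P :=
    Integrable.of_bound (by fun_prop) K (Filter.Eventually.of_forall bN')
  have iNM : Integrable (fun ω => ((M ω)⁻¹ * N ω) * ((M ω)⁻¹ * M' ω)) P := by
    refine Integrable.of_bound (by fun_prop) (1 * K') (Filter.Eventually.of_forall fun ω => ?_)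
    rw [Real.norm_eq_abs, abs_mul]
    exact mul_le_mul (bN ω) (bM' ω) (abs_nonneg _) zero_le_one
  -- inner integration by parts
  have inner : ∀ ω, ∫ u, h (L (ω, u)) * X1 u ∂μ = a1 * N' ω := by
    intro ω
    have := ibp1 (fun u => h (L (ω, u))) (fun u => a1 * h' (L (ω, u))) (fun u => ?_)
      (gh.integrable hμ L ω)
      (by simpa only [mul_comm] using gh.integrable_mul hμ L ω hX1 hX1b)
      ((gh'.integrable hμ L ω).const_mul a1)
    · rw [integral_const_mul] at this
      simpa only [mul_comm] using this
    · have h1 := deriv_shift dh a1 (L (ω, u)) 0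
      have h2 : ∀ r : ℝ, L (ω, u + r • v1) = L (ω, u) + (r * a1) • d := by
        intro r
        have : ((ω, u + r • v1) : E × F) = (ω, u) + r • (0, v1) := by ext <;> simp
        rw [this, map_add, map_smul, hL1, smul_smul]
      simpa [h2] using h1
  have iX2 : Integrable (fun ω => X2 ω * ((M ω)⁻¹ * N ω)) P :=
    hX2.mul_bdd (c := 1) (by fun_prop) (Filter.Eventually.of_forall bN)
  have outer : ∫ ω, X2 ω * ((M ω)⁻¹ * N ω) ∂P
      = ∫ ω, a2 * ((M ω)⁻¹ * N' ω) - a2 * (((M ω)⁻¹ * N ω) * ((M ω)⁻¹ * M' ω)) ∂P := by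
    refine ibp2 _ _ (fun ω => ?_) iN iX2 ((iN'.const_mul a2).sub (iNM.const_mul a2))
    have e1 : HasDerivAt (fun r : ℝ => M (ω + r • v2)) (a2 * M' ω) 0 :=
      deriv_int hμ L gz gz' dz hL2 ω
    have e2 : HasDerivAt (fun r : ℝ => N (ω + r • v2)) (a2 * N' ω) 0 :=
      deriv_int hμ L gh gh' dh hL2 ω
    have e3 := (e1.inv (by simpa using (Mpos ω).ne')).mul e2
    refine e3.congr_deriv ?_
    have := (Mpos ω).ne'
    simp only [zero_smul, add_zero, Pi.inv_apply]
    field_simp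
    ring
  have r1 : (fun ω => (M ω)⁻¹ * ∫ u, h (L (ω, u)) * X1 u ∂μ) = fun ω => a1 * ((M ω)⁻¹ * N' ω) := by
    funext ω; rw [inner]; ring
  have r2 : (fun ω => (M ω)⁻¹ * ∫ u, h (L (ω, u)) * X2 ω ∂μ)
      = fun ω => X2 ω * ((M ω)⁻¹ * N ω) := by
    funext ω; rw [integral_mul_const]; ring
  rw [r1, r2]
  refine ⟨iN'.const_mul a1, iX2, ?_⟩
  rw [outer, integral_sub (iN'.const_mul a2) (iNM.const_mul a2), integral_const_mul,
    integral_const_mul, integral_const_mul]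
  field_simp
  ring

end abs

/-! ### The concrete functions of the exponent matrix -/

section conc
variable {l : ℕ}

/-- `C` as a function of the exponents. -/
def Cf (β : ℝ) (i : Fin l) (D : Fin l → Fin l → ℝ) : ℝ := ∑ k, Real.exp (β * D i k)

/-- `Z` as a function of the exponents. -/
def Zf (β s : ℝ) (D : Fin l → Fin l → ℝ) : ℝ := ∑ i, Cf β i D ^ s

/-- `Z ^ m1`. -/
def zf (β s m1 : ℝ) (D : Fin l → Fin l → ℝ) : ℝ := Zf β s D ^ m1

/-- The unnormalised weight. -/
def hf (β s m1 : ℝ) (i k : Fin l) (D : Fin l → Fin l → ℝ) : ℝ :=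
  Zf β s D ^ (m1 - 1) * Cf β i D ^ (s - 1) * Real.exp (β * D i k)

/-- Directional derivative of `C`. -/
def Cf' (β : ℝ) (d : Fin l → Fin l → ℝ) (i : Fin l) (D : Fin l → Fin l → ℝ) : ℝ :=
  ∑ k, Real.exp (β * D i k) * (β * d i k)

/-- Directional derivative of `Z`. -/
def Zf' (β s : ℝ) (d : Fin l → Fin l → ℝ) (D : Fin l → Fin l → ℝ) : ℝ :=
  ∑ i, Cf' β d i D * s * Cf β i D ^ (s - 1)

/-- Directional derivative of `Z ^ m1`. -/
def zf' (β s m1 : ℝ) (d : Fin l → Fin l → ℝ) (D : Fin l → Fin l → ℝ) : ℝ :=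
  ∑ i, ∑ k, m1 * s * β * d i k * hf β s m1 i k D

/-- Directional derivative of `hf`. -/
def hf' (β s m1 : ℝ) (d : Fin l → Fin l → ℝ) (i k : Fin l) (D : Fin l → Fin l → ℝ) : ℝ :=
  (Zf' β s d D * (m1 - 1) * Zf β s D ^ (m1 - 1 - 1) * Cf β i D ^ (s - 1)
    + Zf β s D ^ (m1 - 1) * (Cf' β d i D * (s - 1) * Cf β i D ^ (s - 1 - 1)))
      * Real.exp (β * D i k)
    + Zf β s D ^ (m1 - 1) * Cf β i D ^ (s - 1) * (Real.exp (β * D i k) * (β * d i k))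

variable (β s m1 : ℝ) (d D : Fin l → Fin l → ℝ) (i k : Fin l)

lemma A_le_Cf : Real.exp (β * D i k) ≤ Cf β i D :=
  Finset.single_le_sum (f := fun k => Real.exp (β * D i k)) (fun _ _ => (Real.exp_pos _).le)
    (Finset.mem_univ k)

lemma Cf_pos : 0 < Cf β i D := (Real.exp_pos _).trans_le (A_le_Cf β D i i)

lemma Cf_le_Zf : Cf β i D ^ s ≤ Zf β s D :=
  Finset.single_le_sum (f := fun i => Cf β i D ^ s)
    (fun j _ => (Real.rpow_pos_of_pos (Cf_pos β D j) s).le) (Finset.mem_univ i)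

lemma Zf_pos (hl : 1 ≤ l) : 0 < Zf β s D :=
  (Real.rpow_pos_of_pos (Cf_pos β D ⟨0, hl⟩) s).trans_le (Cf_le_Zf β s D ⟨0, hl⟩)

lemma cont_Cf : Continuous (Cf β i) := by unfold Cf; fun_prop
lemma cont_Cf' : Continuous (Cf' β d i) := by unfold Cf'; fun_prop
lemma cont_Cfpow (a : ℝ) : Continuous (fun D => Cf β i D ^ a) :=
  (cont_Cf β i).rpow_const fun D => Or.inl (Cf_pos β D i).ne'
lemma cont_Zf : Continuous (Zf (l := l) β s) :=
  continuous_finsetSum _ fun i _ => cont_Cfpow β i s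
lemma cont_Zfpow (hl : 1 ≤ l) (a : ℝ) : Continuous (fun D : Fin l → Fin l → ℝ => Zf β s D ^ a) :=
  (cont_Zf β s).rpow_const fun D => Or.inl (Zf_pos β s D hl).ne'
lemma cont_Zf' : Continuous (Zf' β s d) :=
  continuous_finsetSum _ fun i _ => ((cont_Cf' β d i).mul_const s).mul (cont_Cfpow β i _)
lemma cont_hf (hl : 1 ≤ l) : Continuous (hf β s m1 i k) :=
  ((cont_Zfpow β s hl _).mul (cont_Cfpow β i _)).mul (by fun_prop)
lemma cont_zf' (hl : 1 ≤ l) : Continuous (zf' β s m1 d) :=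
  continuous_finsetSum _ fun i _ => continuous_finsetSum _ fun k _ =>
    (cont_hf β s m1 i k hl).const_mul _
lemma cont_hf' (hl : 1 ≤ l) : Continuous (hf' β s m1 d i k) := by
  have h1 := cont_Zf' β s d
  have h2 := cont_Zfpow (l := l) β s hl
  have h3 := cont_Cfpow β i
  have h4 := cont_Cf' β d i
  unfold hf'
  have h2a := h2 (m1 - 1 - 1)
  have h2b := h2 (m1 - 1)
  have h3a := h3 (s - 1 - 1)
  have h3b := h3 (s - 1)
  fun_prop

lemma hf_pos (hl : 1 ≤ l) : 0 < hf β s m1 i k D := by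
  have := Zf_pos β s D hl
  have := Cf_pos β D i
  unfold hf; positivity

lemma hf_le_zf (hl : 1 ≤ l) : hf β s m1 i k D ≤ zf β s m1 D := by
  have hZ := Zf_pos β s D hl
  have hC := Cf_pos β D i
  unfold hf zf
  have e1 : Zf β s D ^ m1 = Zf β s D ^ (m1 - 1) * Zf β s D := by
    rw [← Real.rpow_add_one hZ.ne']; congr 1; ring
  have e2 : Cf β i D ^ s = Cf β i D ^ (s - 1) * Cf β i D := by
    rw [← Real.rpow_add_one hC.ne']; congr 1; ring
  rw [e1, mul_assoc]
  gcongr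
  refine le_trans ?_ (Cf_le_Zf β s D i)
  rw [e2]
  gcongr
  exact A_le_Cf β D i k

lemma hf_abs_le (hl : 1 ≤ l) : |hf β s m1 i k D| ≤ zf β s m1 D := by
  rw [abs_of_pos (hf_pos β s m1 D i k hl)]; exact hf_le_zf β s m1 D i k hl

lemma d_le : |d i k| ≤ ‖d‖ := by
  rw [← Real.norm_eq_abs]
  exact (norm_le_pi_norm (d i) k).trans (norm_le_pi_norm d i)

lemma Cf'_le : |Cf' β d i D| ≤ |β| * ‖d‖ * Cf β i D := by
  unfold Cf' Cf
  refine (Finset.abs_sum_le_sum_abs _ _).trans ?_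
  rw [Finset.mul_sum]
  refine Finset.sum_le_sum fun k _ => ?_
  rw [abs_mul, abs_mul, Real.abs_exp, mul_comm]
  gcongr
  exact d_le d i k

lemma Zf'_le : |Zf' β s d D| ≤ |s| * (|β| * ‖d‖) * Zf β s D := by
  unfold Zf' Zf
  refine (Finset.abs_sum_le_sum_abs _ _).trans ?_
  rw [Finset.mul_sum]
  refine Finset.sum_le_sum fun i _ => ?_
  have hC := Cf_pos β D i
  have e2 : Cf β i D ^ s = Cf β i D * Cf β i D ^ (s - 1) := by
    rw [mul_comm, ← Real.rpow_add_one hC.ne']; congr 1; ring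
  have := Cf'_le β d D i
  have h0 : 0 < Cf β i D ^ (s - 1) := by positivity
  rw [abs_mul, abs_mul, abs_of_pos h0, e2]
  calc _ ≤ (|β| * ‖d‖ * Cf β i D) * |s| * Cf β i D ^ (s - 1) := by gcongr
    _ = _ := by ring

lemma hf'_le (hl : 1 ≤ l) : |hf' β s m1 d i k D| ≤
    (|s| * (|β| * ‖d‖) * |m1 - 1| + |β| * ‖d‖ * |s - 1| + |β| * ‖d‖) * zf β s m1 D := by
  have hZ := Zf_pos β s D hl
  have hC := Cf_pos β D i
  have e1 : Zf β s D ^ (m1 - 1 - 1) = Zf β s D ^ (m1 - 1) * (Zf β s D)⁻¹ := by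
    rw [Real.rpow_sub_one hZ.ne', div_eq_mul_inv]
  have e2 : Cf β i D ^ (s - 1 - 1) = Cf β i D ^ (s - 1) * (Cf β i D)⁻¹ := by
    rw [Real.rpow_sub_one hC.ne', div_eq_mul_inv]
  have e3 : hf' β s m1 d i k D = (Zf' β s d D * (Zf β s D)⁻¹ * (m1 - 1)
      + Cf' β d i D * (Cf β i D)⁻¹ * (s - 1) + β * d i k) * hf β s m1 i k D := by
    unfold hf' hf; rw [e1, e2]; ring
  rw [e3, abs_mul]
  have b1 : |Zf' β s d D * (Zf β s D)⁻¹| ≤ |s| * (|β| * ‖d‖) := by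
    rw [abs_mul, abs_inv, abs_of_pos hZ, ← div_eq_mul_inv, div_le_iff₀ hZ]; exact Zf'_le β s d D
  have b2 : |Cf' β d i D * (Cf β i D)⁻¹| ≤ |β| * ‖d‖ := by
    rw [abs_mul, abs_inv, abs_of_pos hC, ← div_eq_mul_inv, div_le_iff₀ hC]; exact Cf'_le β d D i
  have b3 : |β * d i k| ≤ |β| * ‖d‖ := by
    rw [abs_mul]; gcongr; exact d_le d i k
  refine mul_le_mul ?_ (hf_abs_le β s m1 D i k hl) (abs_nonneg _) (by positivity)
  refine (abs_add_le _ _).trans (add_le_add ((abs_add_le _ _).trans (add_le_add ?_ ?_)) b3)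
  · rw [abs_mul]; gcongr
  · rw [abs_mul]; gcongr

lemma zf'_le (hl : 1 ≤ l) : |zf' β s m1 d D| ≤
    (∑ i, ∑ k, |m1 * s * β * d i k|) * zf β s m1 D := by
  unfold zf'
  refine (Finset.abs_sum_le_sum_abs _ _).trans ?_
  rw [Finset.sum_mul]
  refine Finset.sum_le_sum fun i _ => (Finset.abs_sum_le_sum_abs _ _).trans ?_
  rw [Finset.sum_mul]
  refine Finset.sum_le_sum fun k _ => ?_
  rw [abs_mul]
  gcongr
  exact hf_abs_le β s m1 D i k hl

lemma zf_pos (hl : 1 ≤ l) : 0 < zf β s m1 D := Real.rpow_pos_of_pos (Zf_pos β s D hl) _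

lemma gd_of_le {f : (Fin l → Fin l → ℝ) → ℝ} (hf : Continuous f) (hz : Gd (zf (l := l) β s m1))
    (K : ℝ) (hK : 0 ≤ K) (hb : ∀ D, |f D| ≤ K * zf β s m1 D) : Gd f := by
  obtain ⟨_, c, k, hc, hk, h⟩ := hz
  refine ⟨hf, K * c, k, by positivity, hk, fun D => (hb D).trans ?_⟩
  rw [mul_assoc]
  gcongr
  exact (le_abs_self _).trans (h D)

lemma rpow_le_exp {c b a : ℝ} (hc : 0 < c) (h1 : Real.exp (-b) ≤ c) (h2 : c ≤ Real.exp b) :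
    c ^ a ≤ Real.exp (|a| * b) := by
  rw [Real.rpow_def_of_pos hc]
  apply Real.exp_le_exp.2
  have h3 : -b ≤ Real.log c := (Real.le_log_iff_exp_le hc).2 h1
  have h4 : Real.log c ≤ b := (Real.log_le_iff_le_exp hc).2 h2
  calc Real.log c * a ≤ |Real.log c * a| := le_abs_self _
    _ = |a| * |Real.log c| := by rw [abs_mul, mul_comm]
    _ ≤ |a| * b := by gcongr; exact abs_le.2 ⟨h3, h4⟩

lemma Cfpow_le : Cf β i D ^ s ≤ Real.exp (|s| * (|β| * ‖D‖ + l)) := by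
  have hA : ∀ k, |β * D i k| ≤ |β| * ‖D‖ := fun k => by
    rw [abs_mul]; gcongr; exact d_le D i k
  refine rpow_le_exp (Cf_pos β D i) ?_ ?_
  · refine le_trans (Real.exp_le_exp.2 ?_) (A_le_Cf β D i i)
    have := (abs_le.1 (hA i)).1
    have : (0 : ℝ) ≤ l := Nat.cast_nonneg l
    linarith
  · unfold Cf
    calc ∑ k, Real.exp (β * D i k) ≤ ∑ k : Fin l, Real.exp (|β| * ‖D‖) :=
          Finset.sum_le_sum fun k _ => Real.exp_le_exp.2 ((le_abs_self _).trans (hA k))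
      _ = l * Real.exp (|β| * ‖D‖) := by simp
      _ ≤ Real.exp l * Real.exp (|β| * ‖D‖) := by
          gcongr; linarith [Real.add_one_le_exp (l : ℝ)]
      _ = _ := by rw [← Real.exp_add, add_comm]

lemma gd_zf (hl : 1 ≤ l) (hm1 : 0 ≤ m1) : Gd (zf (l := l) β s m1) := by
  refine ⟨cont_Zfpow β s hl m1, Real.exp (m1 * (l + |s| * l)), m1 * (|s| * |β|),
    by positivity, by positivity, fun D => ?_⟩
  rw [abs_of_pos (zf_pos β s m1 D hl), ← Real.exp_add]
  have h1 : Zf β s D ≤ Real.exp (l + |s| * (|β| * ‖D‖ + l)) := by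
    unfold Zf
    calc ∑ i, Cf β i D ^ s ≤ ∑ i : Fin l, Real.exp (|s| * (|β| * ‖D‖ + l)) :=
          Finset.sum_le_sum fun i _ => Cfpow_le β s D i
      _ = l * Real.exp (|s| * (|β| * ‖D‖ + l)) := by simp
      _ ≤ Real.exp l * Real.exp (|s| * (|β| * ‖D‖ + l)) := by
          gcongr; linarith [Real.add_one_le_exp (l : ℝ)]
      _ = _ := by rw [← Real.exp_add]
  unfold zf
  calc Zf β s D ^ m1 ≤ (Real.exp (l + |s| * (|β| * ‖D‖ + l))) ^ m1 :=
        Real.rpow_le_rpow (Zf_pos β s D hl).le h1 hm1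
    _ = _ := by rw [← Real.exp_mul]; congr 1; ring

lemma deriv_A : HasDerivAt (fun r : ℝ => Real.exp (β * (D + r • d) i k))
    (Real.exp (β * D i k) * (β * d i k)) 0 := by
  have h1 : HasDerivAt (fun r : ℝ => β * (D i k + r * d i k)) (β * d i k) 0 := by
    simpa using (((hasDerivAt_id (0:ℝ)).mul_const (d i k)).const_add (D i k)).const_mul β
  simpa using h1.exp

lemma deriv_Cf : HasDerivAt (fun r : ℝ => Cf β i (D + r • d)) (Cf' β d i D) 0 := by
  unfold Cf Cf'
  exact HasDerivAt.fun_sum fun k _ => deriv_A β d D i k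

lemma deriv_Cfpow (a : ℝ) : HasDerivAt (fun r : ℝ => Cf β i (D + r • d) ^ a)
    (Cf' β d i D * a * Cf β i D ^ (a - 1)) 0 := by
  have := (deriv_Cf β d D i).rpow_const (p := a) (Or.inl (Cf_pos β _ i).ne')
  simpa using this

lemma deriv_Zf : HasDerivAt (fun r : ℝ => Zf β s (D + r • d)) (Zf' β s d D) 0 := by
  unfold Zf Zf'
  exact HasDerivAt.fun_sum fun k _ => deriv_Cfpow β d D k s

lemma deriv_Zfpow (hl : 1 ≤ l) (a : ℝ) : HasDerivAt (fun r : ℝ => Zf β s (D + r • d) ^ a)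
    (Zf' β s d D * a * Zf β s D ^ (a - 1)) 0 := by
  have := (deriv_Zf β s d D).rpow_const (p := a) (Or.inl (Zf_pos β s _ hl).ne')
  simpa using this

lemma deriv_zf (hl : 1 ≤ l) : HasDerivAt (fun r : ℝ => zf β s m1 (D + r • d))
    (zf' β s m1 d D) 0 := by
  refine (deriv_Zfpow β s d D hl m1).congr_deriv ?_
  unfold zf' Zf' Cf' hf
  simp only [Finset.sum_mul]
  refine Finset.sum_congr rfl fun i _ => Finset.sum_congr rfl fun k _ => ?_
  ring

lemma deriv_hf (hl : 1 ≤ l) : HasDerivAt (fun r : ℝ => hf β s m1 i k (D + r • d))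
    (hf' β s m1 d i k D) 0 := by
  have := ((deriv_Zfpow β s d D hl (m1 - 1)).mul (deriv_Cfpow β d D i (s - 1))).mul
    (deriv_A β d D i k)
  refine this.congr_deriv ?_
  simp [hf']

end conc

/-! ### Assembling -/

section fin
variable {m n l : ℕ}

/-- The exponents as a linear map of the Gaussian variables. -/
def DL (β s t m1 p0 p1 q0 q1 : ℝ) (x : Fin l → Fin n → ℝ) (y : Fin l → Fin m → ℝ) :
    (((Fin m → Fin n → ℝ) × Us m n) × Us m n) →ₗ[ℝ] (Fin l → Fin l → ℝ) where
  toFun p := fun i1 i2 => D0 β s t m1 p0 p1 q0 q1 x y p.1.1 p.2 p.1.2 i1 i2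
  map_add' := by
    intro a b
    funext i1 i2
    have e1 : ∑ j, ∑ k, y i2 j * ((a + b).1.1 j k * x i1 k) =
        ∑ j, ∑ k, y i2 j * (a.1.1 j k * x i1 k) + ∑ j, ∑ k, y i2 j * (b.1.1 j k * x i1 k) := by
      simp only [← Finset.sum_add_distrib]
      refine Finset.sum_congr rfl fun j _ => Finset.sum_congr rfl fun k _ => ?_
      simp only [Prod.fst_add, Pi.add_apply]; ring
    have e2 : ∑ j, y i2 j * (√(p0 - p1) * (a + b).2.2.1 j + √p1 * (a + b).1.2.2.1 j) =
        ∑ j, y i2 j * (√(p0 - p1) * a.2.2.1 j + √p1 * a.1.2.2.1 j)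
        + ∑ j, y i2 j * (√(p0 - p1) * b.2.2.1 j + √p1 * b.1.2.2.1 j) := by
      simp only [← Finset.sum_add_distrib]
      refine Finset.sum_congr rfl fun j _ => ?_
      simp only [Prod.fst_add, Prod.snd_add, Pi.add_apply]; ring
    have e3 : ∑ k, (√(q0 - q1) * (a + b).2.2.2 k + √q1 * (a + b).1.2.2.2 k) * x i1 k =
        ∑ k, (√(q0 - q1) * a.2.2.2 k + √q1 * a.1.2.2.2 k) * x i1 k
        + ∑ k, (√(q0 - q1) * b.2.2.2 k + √q1 * b.1.2.2.2 k) * x i1 k := by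
      simp only [← Finset.sum_add_distrib]
      refine Finset.sum_congr rfl fun j _ => ?_
      simp only [Prod.fst_add, Prod.snd_add, Pi.add_apply]; ring
    simp only [D0, Pi.add_apply]
    rw [e1, e2, e3]
    simp only [Prod.fst_add, Prod.snd_add]
    ring
  map_smul' := by
    intro c a
    funext i1 i2
    have e1 : ∑ j, ∑ k, y i2 j * ((c • a).1.1 j k * x i1 k) =
        c * ∑ j, ∑ k, y i2 j * (a.1.1 j k * x i1 k) := by
      simp only [Finset.mul_sum]
      refine Finset.sum_congr rfl fun j _ => Finset.sum_congr rfl fun k _ => ?_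
      simp only [Prod.smul_fst, Pi.smul_apply, smul_eq_mul]; ring
    have e2 : ∑ j, y i2 j * (√(p0 - p1) * (c • a).2.2.1 j + √p1 * (c • a).1.2.2.1 j) =
        c * ∑ j, y i2 j * (√(p0 - p1) * a.2.2.1 j + √p1 * a.1.2.2.1 j) := by
      simp only [Finset.mul_sum]
      refine Finset.sum_congr rfl fun j _ => ?_
      simp only [Prod.smul_fst, Prod.smul_snd, Pi.smul_apply, smul_eq_mul]; ring
    have e3 : ∑ k, (√(q0 - q1) * (c • a).2.2.2 k + √q1 * (c • a).1.2.2.2 k) * x i1 k =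
        c * ∑ k, (√(q0 - q1) * a.2.2.2 k + √q1 * a.1.2.2.2 k) * x i1 k := by
      simp only [Finset.mul_sum]
      refine Finset.sum_congr rfl fun j _ => ?_
      simp only [Prod.smul_fst, Prod.smul_snd, Pi.smul_apply, smul_eq_mul]; ring
    simp only [D0, Pi.smul_apply]
    rw [e1, e2, e3]
    simp only [Prod.smul_fst, Prod.smul_snd, smul_eq_mul, RingHom.id_apply]
    ring

variable (β s t m1 p0 p1 q0 q1 : ℝ) (x : Fin l → Fin n → ℝ) (y : Fin l → Fin m → ℝ)

/-- The weight `Z^(m1-1) C^(s-1) A`. -/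
def Hq (G : Fin m → Fin n → ℝ) (U1 U2 : Us m n) (i1 i2 : Fin l) : ℝ :=
  Zq β s t m1 p0 p1 q0 q1 x y G U1 U2 ^ (m1 - 1) *
    Cq β s t m1 p0 p1 q0 q1 x y G U1 U2 i1 ^ (s - 1) *
    Aq β s t m1 p0 p1 q0 q1 x y G U1 U2 i1 i2

/-- Generic first type `T`. -/
def TG1 (X : Us m n → ℝ) (i1 i2 : Fin l) : ℝ :=
  ∫ ω, (∫ U1, Zq β s t m1 p0 p1 q0 q1 x y ω.1 U1 ω.2 ^ m1 ∂ muU m n)⁻¹ *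
      (∫ U1, Hq β s t m1 p0 p1 q0 q1 x y ω.1 U1 ω.2 i1 i2 * X U1 ∂ muU m n) ∂ muGU m n

/-- Generic second type `T`. -/
def TG2 (X : Us m n → ℝ) (i1 i2 : Fin l) : ℝ :=
  ∫ ω, (∫ U1, Zq β s t m1 p0 p1 q0 q1 x y ω.1 U1 ω.2 ^ m1 ∂ muU m n)⁻¹ *
      (∫ U1, Hq β s t m1 p0 p1 q0 q1 x y ω.1 U1 ω.2 i1 i2 * X ω.2 ∂ muU m n) ∂ muGU m n

lemma gam01_eq (hl : 1 ≤ l) (G : Fin m → Fin n → ℝ) (U2 : Us m n) (i1 i2 : Fin l) :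
    Phiq β s t m1 p0 p1 q0 q1 x y G U2 (gam0 β s t m1 p0 p1 q0 q1 x y G U2 i1 i2)
    = (∫ U1, Zq β s t m1 p0 p1 q0 q1 x y G U1 U2 ^ m1 ∂ muU m n)⁻¹ *
      ∫ U1, Hq β s t m1 p0 p1 q0 q1 x y G U1 U2 i1 i2 ∂ muU m n := by
  unfold Phiq
  rw [div_eq_inv_mul]
  congr 1
  refine integral_congr_ae (Filter.Eventually.of_forall fun U1 => ?_)
  have hZ : 0 < Zq β s t m1 p0 p1 q0 q1 x y G U1 U2 :=
    Zf_pos β s (DL β s t m1 p0 p1 q0 q1 x y ((G, U2), U1)) hl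
  have hC : 0 < Cq β s t m1 p0 p1 q0 q1 x y G U1 U2 i1 :=
    Cf_pos β (DL β s t m1 p0 p1 q0 q1 x y ((G, U2), U1)) i1
  simp only [gam0, Hq]
  rw [Real.rpow_sub_one hZ.ne', Real.rpow_sub_one hC.ne']
  ring

/-- `E γ₂`. -/
def g2 (i1 i2 pp1 pp2 : Fin l) : ℝ :=
  ∫ ω, gam2 β s t m1 p0 p1 q0 q1 x y ω.1 ω.2 i1 i2 pp1 pp2 ∂ muGU m n

/-- The continuous linear version of `DL`. -/
def DLc : (((Fin m → Fin n → ℝ) × Us m n) × Us m n) →L[ℝ] (Fin l → Fin l → ℝ) :=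
  LinearMap.toContinuousLinearMap (DL β s t m1 p0 p1 q0 q1 x y)

lemma gd_hf (hl : 1 ≤ l) (hm1 : 0 ≤ m1) (i k : Fin l) : Gd (hf β s m1 i k) :=
  gd_of_le β s m1 (cont_hf β s m1 i k hl) (gd_zf β s m1 hl hm1) 1 zero_le_one
    (by simpa using fun D => hf_abs_le β s m1 D i k hl)

lemma integrable_gam2 (hl : 1 ≤ l) (hm1 : 0 ≤ m1) (i1 i2 pp1 pp2 : Fin l) :
    Integrable (fun ω => gam2 β s t m1 p0 p1 q0 q1 x y ω.1 ω.2 i1 i2 pp1 pp2) (muGU m n) := by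
  set L := DLc β s t m1 p0 p1 q0 q1 x y with hL
  have mz : Measurable (fun ω => ∫ u, zf β s m1 (L (ω, u)) ∂(muU m n)) :=
    meas_int L (gd_zf β s m1 hl hm1)
  have mh : ∀ i k, Measurable (fun ω => ∫ u, hf β s m1 i k (L (ω, u)) ∂(muU m n)) :=
    fun i k => meas_int L (gd_hf β s m1 hl hm1 i k)
  have bd : ∀ i k ω, |(∫ u, zf β s m1 (L (ω, u)) ∂(muU m n))⁻¹ *
      ∫ u, hf β s m1 i k (L (ω, u)) ∂(muU m n)| ≤ 1 := by
    intro i k ω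
    have h1 : ∫ u, hf β s m1 i k (L (ω, u)) ∂(muU m n) ≤ ∫ u, zf β s m1 (L (ω, u)) ∂(muU m n) :=
      integral_mono ((gd_hf β s m1 hl hm1 i k).integrable (expM_muU m n) L ω)
        ((gd_zf β s m1 hl hm1).integrable (expM_muU m n) L ω) fun u => hf_le_zf β s m1 _ i k hl
    have h0 : 0 ≤ ∫ u, hf β s m1 i k (L (ω, u)) ∂(muU m n) :=
      integral_nonneg fun u => (hf_pos β s m1 _ i k hl).le
    rw [abs_of_nonneg (mul_nonneg (inv_nonneg.2 (h0.trans h1)) h0)]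
    exact inv_mul_le_one_of_le₀ h1 (h0.trans h1)
  have e : (fun ω : (Fin m → Fin n → ℝ) × Us m n =>
      gam2 β s t m1 p0 p1 q0 q1 x y ω.1 ω.2 i1 i2 pp1 pp2) = fun ω =>
      ((∫ u, zf β s m1 (L (ω, u)) ∂(muU m n))⁻¹ * ∫ u, hf β s m1 i1 i2 (L (ω, u)) ∂(muU m n)) *
      ((∫ u, zf β s m1 (L (ω, u)) ∂(muU m n))⁻¹ *
        ∫ u, hf β s m1 pp1 pp2 (L (ω, u)) ∂(muU m n)) := by
    funext ω
    unfold gam2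
    rw [gam01_eq _ _ _ _ _ _ _ _ _ _ hl, gam01_eq _ _ _ _ _ _ _ _ _ _ hl]
    rfl
  rw [e]
  have h1 := mh i1 i2
  have h2 := mh pp1 pp2
  refine Integrable.of_bound (by fun_prop) 1 (Filter.Eventually.of_forall fun ω => ?_)
  rw [Real.norm_eq_abs, abs_mul]
  exact mul_le_one₀ (bd _ _ _) (abs_nonneg _) (bd _ _ _)

lemma EB2_eq (hl : 1 ≤ l) (hm1 : 0 ≤ m1) (f : Fin l → Fin l → Fin l → Fin l → ℝ) :
    EB2 β s t m1 p0 p1 q0 q1 x y f = ∑ i1, ∑ i2, ∑ pp1, ∑ pp2,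
      f i1 i2 pp1 pp2 * g2 β s t m1 p0 p1 q0 q1 x y i1 i2 pp1 pp2 := by
  unfold EB2 g2
  have hi := fun i1 i2 pp1 pp2 => (integrable_gam2 β s t m1 p0 p1 q0 q1 x y hl hm1
    i1 i2 pp1 pp2).const_mul (f i1 i2 pp1 pp2)
  rw [integral_finsetSum _ fun i1 _ => integrable_finsetSum _ fun i2 _ =>
    integrable_finsetSum _ fun pp1 _ => integrable_finsetSum _ fun pp2 _ => hi i1 i2 pp1 pp2]
  refine Finset.sum_congr rfl fun i1 _ => ?_
  rw [integral_finsetSum _ fun i2 _ =>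
    integrable_finsetSum _ fun pp1 _ => integrable_finsetSum _ fun pp2 _ => hi i1 i2 pp1 pp2]
  refine Finset.sum_congr rfl fun i2 _ => ?_
  rw [integral_finsetSum _ fun pp1 _ => integrable_finsetSum _ fun pp2 _ => hi i1 i2 pp1 pp2]
  refine Finset.sum_congr rfl fun pp1 _ => ?_
  rw [integral_finsetSum _ fun pp2 _ => hi i1 i2 pp1 pp2]
  refine Finset.sum_congr rfl fun pp2 _ => ?_
  rw [integral_const_mul]

/-- The conclusion of the concrete cancellation lemma. -/
def CM (X : Us m n → ℝ) (a1 a2 : ℝ) (d : Fin l → Fin l → ℝ) : Prop :=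
  ∀ i1 i2 : Fin l,
    (∀ ω : (Fin m → Fin n → ℝ) × Us m n,
      Integrable (fun U1 => Hq β s t m1 p0 p1 q0 q1 x y ω.1 U1 ω.2 i1 i2 * X U1) (muU m n)) ∧
    (∀ ω : (Fin m → Fin n → ℝ) × Us m n,
      Integrable (fun U1 => Hq β s t m1 p0 p1 q0 q1 x y ω.1 U1 ω.2 i1 i2 * X ω.2) (muU m n)) ∧
    Integrable (fun ω : (Fin m → Fin n → ℝ) × Us m n =>
      (∫ U1, Zq β s t m1 p0 p1 q0 q1 x y ω.1 U1 ω.2 ^ m1 ∂ muU m n)⁻¹ *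
      (∫ U1, Hq β s t m1 p0 p1 q0 q1 x y ω.1 U1 ω.2 i1 i2 * X U1 ∂ muU m n)) (muGU m n) ∧
    Integrable (fun ω : (Fin m → Fin n → ℝ) × Us m n =>
      (∫ U1, Zq β s t m1 p0 p1 q0 q1 x y ω.1 U1 ω.2 ^ m1 ∂ muU m n)⁻¹ *
      (∫ U1, Hq β s t m1 p0 p1 q0 q1 x y ω.1 U1 ω.2 i1 i2 * X ω.2 ∂ muU m n)) (muGU m n) ∧
    a2⁻¹ * TG2 β s t m1 p0 p1 q0 q1 x y X i1 i2 - a1⁻¹ * TG1 β s t m1 p0 p1 q0 q1 x y X i1 i2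
      = - ∑ pp1, ∑ pp2, m1 * s * β * d pp1 pp2 *
          g2 β s t m1 p0 p1 q0 q1 x y i1 i2 pp1 pp2

lemma conc_main (hl : 1 ≤ l) (hm1 : 0 ≤ m1) (X : Us m n → ℝ) (v : Us m n)
    (hX : Continuous X) (hXb : ∀ u, |X u| ≤ ‖u‖) (ibp : HasIBP (muU m n) X v)
    (a1 a2 : ℝ) (ha1 : a1 ≠ 0) (ha2 : a2 ≠ 0) (d : Fin l → Fin l → ℝ)
    (h1 : ∀ i k, D0 β s t m1 p0 p1 q0 q1 x y 0 v 0 i k = a1 * d i k)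
    (h2 : ∀ i k, D0 β s t m1 p0 p1 q0 q1 x y 0 0 v i k = a2 * d i k) :
    CM β s t m1 p0 p1 q0 q1 x y X a1 a2 d := by
  intro i1 i2
  set L := DLc β s t m1 p0 p1 q0 q1 x y with hL
  have gh := gd_hf β s m1 hl hm1 (l := l)
  have gz := gd_zf β s m1 hl hm1 (l := l)
  have gz' : Gd (zf' β s m1 d) := gd_of_le β s m1 (cont_zf' β s m1 d hl) gz _
    (Finset.sum_nonneg fun _ _ => Finset.sum_nonneg fun _ _ => abs_nonneg _)
    (fun D => zf'_le β s m1 d D hl)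
  have gh' : Gd (hf' β s m1 d i1 i2) := gd_of_le β s m1 (cont_hf' β s m1 d i1 i2 hl) gz _
    (by positivity) (fun D => hf'_le β s m1 d D i1 i2 hl)
  have iX : Integrable X (muU m n) := by
    refine (expM_muU m n 1).mono' hX.aestronglyMeasurable (Filter.Eventually.of_forall fun u => ?_)
    rw [one_mul, Real.norm_eq_abs]
    exact (hXb u).trans (by linarith [Real.add_one_le_exp ‖u‖])
  have key := main_abs (muGU m n) (muU m n) L d (0, v) v a1 a2 ha1 ha2
    (by funext i k; exact h2 i k) (by funext i k; exact h1 i k)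
    (fun ω => X ω.2) X (iX.comp_snd (gMat m n)) hX hXb
    (HasIBP.prod_right ibp) ibp (expM_muU m n) (zf β s m1) (hf β s m1 i1 i2) (zf' β s m1 d)
    (hf' β s m1 d i1 i2) gz (gh i1 i2) gz' gh' (fun D => zf_pos β s m1 D hl) _ _
    (fun D => hf_abs_le β s m1 D i1 i2 hl) (fun D => hf'_le β s m1 d D i1 i2 hl)
    (fun D => zf'_le β s m1 d D hl) (fun D => deriv_hf β s m1 d D i1 i2 hl)
    (fun D => deriv_zf β s m1 d D hl)
  refine ⟨fun ω => (gh i1 i2).integrable_mul (expM_muU m n) L ω hX hXb,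
    fun ω => ((gh i1 i2).integrable (expM_muU m n) L ω).mul_const _, key.1, key.2.1, ?_⟩
  refine Eq.trans key.2.2 ?_
  congr 1
  have e : (fun ω => ((∫ u, zf β s m1 (L (ω, u)) ∂(muU m n))⁻¹ *
        ∫ u, hf β s m1 i1 i2 (L (ω, u)) ∂(muU m n)) *
      ((∫ u, zf β s m1 (L (ω, u)) ∂(muU m n))⁻¹ *
        ∫ u, zf' β s m1 d (L (ω, u)) ∂(muU m n)))
      = fun ω => ∑ pp1, ∑ pp2, m1 * s * β * d pp1 pp2 *
        gam2 β s t m1 p0 p1 q0 q1 x y ω.1 ω.2 i1 i2 pp1 pp2 := by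
    funext ω
    have e1 : ∫ u, zf' β s m1 d (L (ω, u)) ∂(muU m n) = ∑ pp1, ∑ pp2, m1 * s * β * d pp1 pp2 *
        ∫ u, hf β s m1 pp1 pp2 (L (ω, u)) ∂(muU m n) := by
      unfold zf'
      have hi := fun i k => ((gh i k).integrable (expM_muU m n) L ω).const_mul
        (m1 * s * β * d i k)
      rw [integral_finsetSum _ fun i _ => integrable_finsetSum _ fun k _ => hi i k]
      refine Finset.sum_congr rfl fun i _ => ?_
      rw [integral_finsetSum _ fun k _ => hi i k]
      refine Finset.sum_congr rfl fun k _ => ?_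
      rw [integral_const_mul]
    rw [e1]
    simp only [Finset.mul_sum]
    refine Finset.sum_congr rfl fun i _ => Finset.sum_congr rfl fun k _ => ?_
    unfold gam2
    rw [gam01_eq _ _ _ _ _ _ _ _ _ _ hl, gam01_eq _ _ _ _ _ _ _ _ _ _ hl]
    change _ = m1 * s * β * d i k * (((∫ u, zf β s m1 (L (ω, u)) ∂(muU m n))⁻¹ *
        ∫ u, hf β s m1 i1 i2 (L (ω, u)) ∂(muU m n)) *
      ((∫ u, zf β s m1 (L (ω, u)) ∂(muU m n))⁻¹ *
        ∫ u, hf β s m1 i k (L (ω, u)) ∂(muU m n)))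
    ring
  rw [e]
  have hi := fun i k => (integrable_gam2 β s t m1 p0 p1 q0 q1 x y hl hm1 i1 i2 i k).const_mul
        (m1 * s * β * d i k)
  rw [integral_finsetSum _ fun i _ => integrable_finsetSum _ fun k _ => hi i k]
  refine Finset.sum_congr rfl fun i _ => ?_
  rw [integral_finsetSum _ fun k _ => hi i k]
  refine Finset.sum_congr rfl fun k _ => ?_
  rw [integral_const_mul]
  rfl

lemma Us_norm1 (u : Us m n) : |u.1| ≤ ‖u‖ := norm_fst_le u
lemma Us_norm2 (u : Us m n) (j : Fin m) : |u.2.1 j| ≤ ‖u‖ :=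
  (norm_le_pi_norm u.2.1 j).trans ((norm_fst_le u.2).trans (norm_snd_le u))
lemma Us_norm3 (u : Us m n) (j : Fin n) : |u.2.2 j| ≤ ‖u‖ :=
  (norm_le_pi_norm u.2.2 j).trans ((norm_snd_le u.2).trans (norm_snd_le u))

lemma ibp_1 : HasIBP (muU m n) (fun u => u.1) (1, 0, 0) := hasIBP_stdG.prod_left
lemma ibp_2 (j : Fin m) : HasIBP (muU m n) (fun u => u.2.1 j) (0, Pi.single j 1, 0) :=
  HasIBP.prod_right (X := fun u : (Fin m → ℝ) × (Fin n → ℝ) => u.1 j) (hasIBP_gVec j).prod_left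
lemma ibp_3 (j : Fin n) : HasIBP (muU m n) (fun u => u.2.2 j) (0, 0, Pi.single j 1) :=
  HasIBP.prod_right (X := fun u : (Fin m → ℝ) × (Fin n → ℝ) => u.2 j) (hasIBP_gVec j).prod_right

lemma case_1 (hl : 1 ≤ l) (hm1 : 0 ≤ m1) (hp01 : p1 < p0) (hp1pos : 0 < p1) (j : Fin m) :
    CM β s t m1 p0 p1 q0 q1 x y (fun u => u.2.1 j) (√(p0 - p1)) (√p1)
      (fun i k => √(1 - t) * nrm2 (x i) * y k j) :=
  conc_main β s t m1 p0 p1 q0 q1 x y hl hm1 (fun u => u.2.1 j) (0, Pi.single j 1, 0)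
    (by fun_prop) (fun u => Us_norm2 u j) (ibp_2 j) (√(p0 - p1)) (√p1)
    (Real.sqrt_pos.2 (sub_pos.2 hp01)).ne' (Real.sqrt_pos.2 hp1pos).ne'
    (fun i k => √(1 - t) * nrm2 (x i) * y k j)
    (fun i k => by simp [D0, Pi.single_apply]; ring) (fun i k => by simp [D0, Pi.single_apply]; ring)

lemma case_2 (hl : 1 ≤ l) (hm1 : 0 ≤ m1) (hq01 : q1 < q0) (hq1pos : 0 < q1) (j : Fin n) :
    CM β s t m1 p0 p1 q0 q1 x y (fun u => u.2.2 j) (√(q0 - q1)) (√q1)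
      (fun i k => √(1 - t) * nrm2 (y k) * x i j) :=
  conc_main β s t m1 p0 p1 q0 q1 x y hl hm1 (fun u => u.2.2 j) (0, 0, Pi.single j 1)
    (by fun_prop) (fun u => Us_norm3 u j) (ibp_3 j) (√(q0 - q1)) (√q1)
    (Real.sqrt_pos.2 (sub_pos.2 hq01)).ne' (Real.sqrt_pos.2 hq1pos).ne'
    (fun i k => √(1 - t) * nrm2 (y k) * x i j)
    (fun i k => by simp [D0, Pi.single_apply]; ring) (fun i k => by simp [D0, Pi.single_apply]; ring)

lemma case_3 (hl : 1 ≤ l) (hm1 : 0 ≤ m1) (hpq : p1 * q1 < p0 * q0) (hpqpos : 0 < p1 * q1) :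
    CM β s t m1 p0 p1 q0 q1 x y (fun u => u.1) (√(p0 * q0 - p1 * q1)) (√(p1 * q1))
      (fun i k => √t * nrm2 (x i) * nrm2 (y k)) :=
  conc_main β s t m1 p0 p1 q0 q1 x y hl hm1 (fun u => u.1) (1, 0, 0)
    (by fun_prop) (fun u => Us_norm1 u) ibp_1 (√(p0 * q0 - p1 * q1)) (√(p1 * q1))
    (Real.sqrt_pos.2 (sub_pos.2 hpq)).ne' (Real.sqrt_pos.2 hpqpos).ne'
    (fun i k => √t * nrm2 (x i) * nrm2 (y k))
    (fun i k => by simp [D0]; ring) (fun i k => by simp [D0]; ring)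

lemma Tp11_eq (j : Fin m) (i1 i2 : Fin l) : Tp11 β s t m1 p0 p1 q0 q1 x y j i1 i2 =
    y i2 j * TG1 β s t m1 p0 p1 q0 q1 x y (fun u => u.2.1 j) i1 i2 := by
  unfold Tp11 TG1 Hq
  rw [← integral_const_mul]
  congr 1; funext ω
  rw [mul_left_comm]
  congr 1
  rw [← integral_const_mul]
  congr 1; funext U; ring

lemma Tp21_eq (j : Fin m) (i1 i2 : Fin l) : Tp21 β s t m1 p0 p1 q0 q1 x y j i1 i2 =
    y i2 j * TG2 β s t m1 p0 p1 q0 q1 x y (fun u => u.2.1 j) i1 i2 := by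
  unfold Tp21 TG2 Hq
  rw [← integral_const_mul]
  congr 1; funext ω
  rw [mul_left_comm]
  congr 1
  rw [← integral_const_mul]
  congr 1; funext U; ring

lemma Tq12_eq (hl : 1 ≤ l) (hm1 : 0 ≤ m1) (hq01 : q1 < q0) (hq1pos : 0 < q1) (i1 i2 : Fin l) :
    Tq12 β s t m1 p0 p1 q0 q1 x y i1 i2 =
    ∑ k, x i1 k / nrm2 (x i1) * TG1 β s t m1 p0 p1 q0 q1 x y (fun u => u.2.2 k) i1 i2 := by
  have hc := fun k => case_2 β s t m1 p0 p1 q0 q1 x y hl hm1 hq01 hq1pos k i1 i2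
  unfold Tq12 TG1
  trans ∫ ω, ∑ k, x i1 k / nrm2 (x i1) * ((∫ U1, Zq β s t m1 p0 p1 q0 q1 x y ω.1 U1 ω.2 ^ m1 ∂ muU m n)⁻¹ *
    ∫ U1, Hq β s t m1 p0 p1 q0 q1 x y ω.1 U1 ω.2 i1 i2 * U1.2.2 k ∂ muU m n) ∂ muGU m n
  · refine integral_congr_ae (Filter.Eventually.of_forall fun ω => ?_)
    simp only [mul_left_comm (_ / _)]
    rw [← Finset.mul_sum]
    congr 1
    trans ∫ U1, ∑ k, x i1 k / nrm2 (x i1) * (Hq β s t m1 p0 p1 q0 q1 x y ω.1 U1 ω.2 i1 i2 * U1.2.2 k) ∂ muU m n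
    · refine integral_congr_ae (Filter.Eventually.of_forall fun U => ?_)
      simp only [dotv, Hq, Finset.sum_div, Finset.mul_sum]
      refine Finset.sum_congr rfl fun k _ => ?_
      ring
    · rw [integral_finsetSum _ fun k _ => ((hc k).1 ω).const_mul _]
      refine Finset.sum_congr rfl fun k _ => ?_
      rw [integral_const_mul]
  · rw [integral_finsetSum _ fun k _ => ((hc k).2.2.1).const_mul _]
    refine Finset.sum_congr rfl fun k _ => ?_
    rw [integral_const_mul]

lemma Tq22_eq (hl : 1 ≤ l) (hm1 : 0 ≤ m1) (hq01 : q1 < q0) (hq1pos : 0 < q1) (i1 i2 : Fin l) :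
    Tq22 β s t m1 p0 p1 q0 q1 x y i1 i2 =
    ∑ k, x i1 k / nrm2 (x i1) * TG2 β s t m1 p0 p1 q0 q1 x y (fun u => u.2.2 k) i1 i2 := by
  have hc := fun k => case_2 β s t m1 p0 p1 q0 q1 x y hl hm1 hq01 hq1pos k i1 i2
  unfold Tq22 TG2
  trans ∫ ω, ∑ k, x i1 k / nrm2 (x i1) * ((∫ U1, Zq β s t m1 p0 p1 q0 q1 x y ω.1 U1 ω.2 ^ m1 ∂ muU m n)⁻¹ *
    ∫ U1, Hq β s t m1 p0 p1 q0 q1 x y ω.1 U1 ω.2 i1 i2 * ω.2.2.2 k ∂ muU m n) ∂ muGU m n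
  · refine integral_congr_ae (Filter.Eventually.of_forall fun ω => ?_)
    simp only [mul_left_comm (_ / _)]
    rw [← Finset.mul_sum]
    congr 1
    trans ∫ U1, ∑ k, x i1 k / nrm2 (x i1) * (Hq β s t m1 p0 p1 q0 q1 x y ω.1 U1 ω.2 i1 i2 * ω.2.2.2 k) ∂ muU m n
    · refine integral_congr_ae (Filter.Eventually.of_forall fun U => ?_)
      simp only [dotv, Hq, Finset.sum_div, Finset.mul_sum]
      refine Finset.sum_congr rfl fun k _ => ?_
      ring
    · rw [integral_finsetSum _ fun k _ => ((hc k).2.1 ω).const_mul _]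
      refine Finset.sum_congr rfl fun k _ => ?_
      rw [integral_const_mul]
  · rw [integral_finsetSum _ fun k _ => ((hc k).2.2.2.1).const_mul _]
    refine Finset.sum_congr rfl fun k _ => ?_
    rw [integral_const_mul]

lemma nrm2_ne {d : ℕ} {v : Fin d → ℝ} (hv : v ≠ 0) : nrm2 v ≠ 0 := by
  intro h
  apply hv
  unfold nrm2 at h
  rw [Real.sqrt_eq_zero (by positivity)] at h
  funext i
  have := (Finset.sum_eq_zero_iff_of_nonneg (fun i _ => sq_nonneg (v i))).1 h i (Finset.mem_univ i)
  simpa using this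

end fin

/-- First-level cancellation identities for the `Ω`-terms. -/
theorem first_level_Omega_cancellation
    (m n l : ℕ) (hm : 1 ≤ m) (hn : 1 ≤ n) (hl : 1 ≤ l)
    (β s t m1 p0 p1 q0 q1 : ℝ)
    (hβ : 0 < β) (hs : s ≠ 0) (ht : t ∈ Set.Ioo (0:ℝ) 1) (hm1 : m1 ∈ Set.Ioc (0:ℝ) 1)
    (hp : p1 ≤ p0) (hp1 : 0 ≤ p1) (hq : q1 ≤ q0) (hq1 : 0 ≤ q1)
    (x : Fin l → Fin n → ℝ) (y : Fin l → Fin m → ℝ)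
    (hx : ∀ i, x i ≠ 0) (hy : ∀ i, y i ≠ 0)
    (hp01 : p1 < p0) (hp1pos : 0 < p1) (hq01 : q1 < q0) (hq1pos : 0 < q1)
    (hpq : p1 * q1 < p0 * q0) (hpqpos : 0 < p1 * q1) :
    (-(∑ i1, ∑ i2, ∑ j, β * nrm2 (x i1) *
          (Real.sqrt (1 - t) / Real.sqrt p1 * Tp21 β s t m1 p0 p1 q0 q1 x y j i1 i2
            - Real.sqrt (1 - t) / Real.sqrt (p0 - p1) * Tp11 β s t m1 p0 p1 q0 q1 x y j i1 i2))
        = (1 - t) * s * β ^ 2 * m1 * EB2 β s t m1 p0 p1 q0 q1 x y (fun i1 i2 pp1 pp2 => nrm2 (x i1) * nrm2 (x pp1) * dotv (y pp2) (y i2)))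
    ∧
    (-(∑ i1, ∑ i2, β * nrm2 (x i1) * nrm2 (y i2) *
          (Real.sqrt (1 - t) / Real.sqrt q1 * Tq22 β s t m1 p0 p1 q0 q1 x y i1 i2
            - Real.sqrt (1 - t) / Real.sqrt (q0 - q1) * Tq12 β s t m1 p0 p1 q0 q1 x y i1 i2))
        = (1 - t) * s * β ^ 2 * m1 * EB2 β s t m1 p0 p1 q0 q1 x y (fun i1 i2 pp1 pp2 => nrm2 (y i2) * nrm2 (y pp2) * dotv (x pp1) (x i1)))
    ∧
    (-(∑ i1, ∑ i2, β * nrm2 (x i1) * nrm2 (y i2) *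
          (Real.sqrt t / Real.sqrt (p1 * q1) * Tpq23 β s t m1 p0 p1 q0 q1 x y i1 i2
            - Real.sqrt t / Real.sqrt (p0 * q0 - p1 * q1) * Tpq13 β s t m1 p0 p1 q0 q1 x y i1 i2))
        = t * s * β ^ 2 * m1 * EB2 β s t m1 p0 p1 q0 q1 x y (fun i1 i2 pp1 pp2 => nrm2 (x i1) * nrm2 (x pp1) * nrm2 (y i2) * nrm2 (y pp2))) := by
  obtain ⟨ht0, ht1⟩ := ht
  have hm0 : 0 ≤ m1 := hm1.1.le
  have st : √(1 - t) * √(1 - t) = 1 - t := Real.mul_self_sqrt (by linarith)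
  have st' : √t * √t = t := Real.mul_self_sqrt ht0.le
  refine ⟨?_, ?_, ?_⟩
  · rw [EB2_eq _ _ _ _ _ _ _ _ _ _ hl hm0]
    simp only [Finset.mul_sum, ← Finset.sum_neg_distrib]
    refine Finset.sum_congr rfl fun i1 _ => Finset.sum_congr rfl fun i2 _ => ?_
    have e : ∀ j, -(β * nrm2 (x i1) *
          (√(1 - t) / √p1 * Tp21 β s t m1 p0 p1 q0 q1 x y j i1 i2
            - √(1 - t) / √(p0 - p1) * Tp11 β s t m1 p0 p1 q0 q1 x y j i1 i2))
        = ∑ pp1, ∑ pp2, (1 - t) * s * β ^ 2 * m1 * (nrm2 (x i1) * nrm2 (x pp1) *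
            (y pp2 j * y i2 j) * g2 β s t m1 p0 p1 q0 q1 x y i1 i2 pp1 pp2) := by
      intro j
      have hc := (case_1 β s t m1 p0 p1 q0 q1 x y hl hm0 hp01 hp1pos j i1 i2).2.2.2.2
      rw [Tp21_eq, Tp11_eq]
      trans -(β * nrm2 (x i1) * √(1 - t) * y i2 j *
        ((√p1)⁻¹ * TG2 β s t m1 p0 p1 q0 q1 x y (fun u => u.2.1 j) i1 i2
          - (√(p0 - p1))⁻¹ * TG1 β s t m1 p0 p1 q0 q1 x y (fun u => u.2.1 j) i1 i2))
      · ring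
      rw [hc, mul_neg, neg_neg]
      simp only [Finset.mul_sum]
      refine Finset.sum_congr rfl fun pp1 _ => Finset.sum_congr rfl fun pp2 _ => ?_
      linear_combination (s * β ^ 2 * m1 * (nrm2 (x i1) * nrm2 (x pp1) *
        (y pp2 j * y i2 j) * g2 β s t m1 p0 p1 q0 q1 x y i1 i2 pp1 pp2)) * st
    simp only [e]
    rw [Finset.sum_comm]
    refine Finset.sum_congr rfl fun pp1 _ => ?_
    rw [Finset.sum_comm]
    refine Finset.sum_congr rfl fun pp2 _ => ?_
    simp only [dotv, Finset.mul_sum, Finset.sum_mul]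
  · rw [EB2_eq _ _ _ _ _ _ _ _ _ _ hl hm0]
    simp only [Finset.mul_sum, ← Finset.sum_neg_distrib]
    refine Finset.sum_congr rfl fun i1 _ => Finset.sum_congr rfl fun i2 _ => ?_
    have hx1 := nrm2_ne (hx i1)
    have e : ∀ k, -(β * nrm2 (x i1) * nrm2 (y i2) * √(1 - t) * (x i1 k / nrm2 (x i1)) *
        ((√q1)⁻¹ * TG2 β s t m1 p0 p1 q0 q1 x y (fun u => u.2.2 k) i1 i2
          - (√(q0 - q1))⁻¹ * TG1 β s t m1 p0 p1 q0 q1 x y (fun u => u.2.2 k) i1 i2))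
        = ∑ pp1, ∑ pp2, (1 - t) * s * β ^ 2 * m1 * (nrm2 (y i2) * nrm2 (y pp2) *
            (x pp1 k * x i1 k) * g2 β s t m1 p0 p1 q0 q1 x y i1 i2 pp1 pp2) := by
      intro k
      have hc := (case_2 β s t m1 p0 p1 q0 q1 x y hl hm0 hq01 hq1pos k i1 i2).2.2.2.2
      rw [hc, mul_neg, neg_neg]
      simp only [Finset.mul_sum]
      refine Finset.sum_congr rfl fun pp1 _ => Finset.sum_congr rfl fun pp2 _ => ?_
      have hxk : nrm2 (x i1) * (x i1 k / nrm2 (x i1)) = x i1 k := by field_simp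
      calc _ = (√(1 - t) * √(1 - t)) * s * β ^ 2 * m1 * (nrm2 (y i2) * nrm2 (y pp2) *
            (x pp1 k * (nrm2 (x i1) * (x i1 k / nrm2 (x i1)))) *
            g2 β s t m1 p0 p1 q0 q1 x y i1 i2 pp1 pp2) := by ring
        _ = _ := by rw [st, hxk]
    rw [Tq22_eq _ _ _ _ _ _ _ _ _ _ hl hm0 hq01 hq1pos,
      Tq12_eq _ _ _ _ _ _ _ _ _ _ hl hm0 hq01 hq1pos]
    trans ∑ k, -(β * nrm2 (x i1) * nrm2 (y i2) * √(1 - t) * (x i1 k / nrm2 (x i1)) *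
        ((√q1)⁻¹ * TG2 β s t m1 p0 p1 q0 q1 x y (fun u => u.2.2 k) i1 i2
          - (√(q0 - q1))⁻¹ * TG1 β s t m1 p0 p1 q0 q1 x y (fun u => u.2.2 k) i1 i2))
    · rw [Finset.mul_sum, Finset.mul_sum, ← Finset.sum_sub_distrib, Finset.mul_sum,
        ← Finset.sum_neg_distrib]
      refine Finset.sum_congr rfl fun k _ => ?_
      ring
    simp only [e]
    rw [Finset.sum_comm]
    refine Finset.sum_congr rfl fun pp1 _ => ?_
    rw [Finset.sum_comm]
    refine Finset.sum_congr rfl fun pp2 _ => ?_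
    simp only [dotv, Finset.mul_sum, Finset.sum_mul]
  · rw [EB2_eq _ _ _ _ _ _ _ _ _ _ hl hm0]
    simp only [Finset.mul_sum, ← Finset.sum_neg_distrib]
    refine Finset.sum_congr rfl fun i1 _ => Finset.sum_congr rfl fun i2 _ => ?_
    have hc := (case_3 β s t m1 p0 p1 q0 q1 x y hl hm0 hpq hpqpos i1 i2).2.2.2.2
    trans -(β * nrm2 (x i1) * nrm2 (y i2) * √t *
        ((√(p1 * q1))⁻¹ * TG2 β s t m1 p0 p1 q0 q1 x y (fun u => u.1) i1 i2
          - (√(p0 * q0 - p1 * q1))⁻¹ * TG1 β s t m1 p0 p1 q0 q1 x y (fun u => u.1) i1 i2))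
    · have e1 : Tpq23 β s t m1 p0 p1 q0 q1 x y i1 i2
        = TG2 β s t m1 p0 p1 q0 q1 x y (fun u => u.1) i1 i2 := rfl
      have e2 : Tpq13 β s t m1 p0 p1 q0 q1 x y i1 i2
        = TG1 β s t m1 p0 p1 q0 q1 x y (fun u => u.1) i1 i2 := rfl
      rw [e1, e2]; ring
    rw [hc, mul_neg, neg_neg]
    simp only [Finset.mul_sum]
    refine Finset.sum_congr rfl fun pp1 _ => Finset.sum_congr rfl fun pp2 _ => ?_
    have st2 := st'
    calc _ = (√t * √t) * s * β ^ 2 * m1 * (nrm2 (x i1) * nrm2 (x pp1) * nrm2 (y i2) *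
          nrm2 (y pp2) * g2 β s t m1 p0 p1 q0 q1 x y i1 i2 pp1 pp2) := by ring
      _ = _ := by rw [st']

end

end SFL
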